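/- Let G be a bridgeless cubic graph of order n. If G has a cycle of length at least n − 10, then G has a cycle double cover. -/

import Mathlib

open scoped Classical

namespace SnarkPaper

variable {V : Type*}

/-- A graph is cubic if every vertex has exactly 3 neighbours. -/
def IsCubic (G : SimpleGraph V) : Prop := ∀ v : V, (G.neighborSet v).ncard = 3

/-- A proper 3-edge-colouring: edges sharing an endpoint get different colours. -/
def Colourable3 (G : SimpleGraph V) : Prop :=
  ∃ c : Sym2 V → Fin 3, ∀ e₁ ∈ G.edgeSet, ∀ e₂ ∈ G.edgeSet,
    e₁ ≠ e₂ → (∃ v, v ∈ e₁ ∧ v ∈ e₂) → c e₁ ≠ c e₂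

/-- A subgraph is 2-regular if every one of its vertices has exactly two neighbours in it. -/
def IsTwoRegular {G : SimpleGraph V} (H : G.Subgraph) : Prop :=
  ∀ v ∈ H.verts, (H.neighborSet v).ncard = 2

/-- A cycle is a connected 2-regular subgraph. -/
def IsCycleSub {G : SimpleGraph V} (C : G.Subgraph) : Prop :=
  C.Connected ∧ IsTwoRegular C

/-- A 2-factor is a spanning 2-regular subgraph. -/
def IsTwoFactor {G : SimpleGraph V} (F : G.Subgraph) : Prop :=
  F.IsSpanning ∧ IsTwoRegular F

/-- A 2-factor is even if all its cycles (connected components) have even length. -/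
def IsEvenTwoFactor {G : SimpleGraph V} (F : G.Subgraph) : Prop :=
  IsTwoFactor F ∧ ∀ C : G.Subgraph, C ≤ F → IsCycleSub C → Even C.verts.ncard

/-- An even subgraph: every vertex has even degree. -/
def IsEvenSubgraph {G : SimpleGraph V} (H : G.Subgraph) : Prop :=
  ∀ v : V, Even (H.neighborSet v).ncard

/-- A cycle double cover: a multiset of cycles covering each edge exactly twice. -/
def IsCDC (G : SimpleGraph V) (D : Multiset G.Subgraph) : Prop :=
  (∀ C ∈ D, IsCycleSub C) ∧
  ∀ e ∈ G.edgeSet, D.countP (fun C => e ∈ C.edgeSet) = 2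

/-- A k-CDC, seen as a multiset of k even subgraphs covering each edge exactly twice. -/
def IsKCDC (G : SimpleGraph V) (k : ℕ) (D : Multiset G.Subgraph) : Prop :=
  D.card = k ∧ (∀ H ∈ D, IsEvenSubgraph H) ∧
  ∀ e ∈ G.edgeSet, D.countP (fun H => e ∈ H.edgeSet) = 2

/-- An edge set is even if every vertex meets an even number of its edges. -/
def EvenEdgeSet (S : Set (Sym2 V)) : Prop :=
  ∀ v : V, Even {w : V | s(v, w) ∈ S}.ncard

/-- A k-CDC presented as a multiset of k even edge sets covering each edge exactly twice. -/
def IsKCDCEdgeSets (G : SimpleGraph V) (k : ℕ) (D : Multiset (Set (Sym2 V))) : Prop :=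
  D.card = k ∧ (∀ S ∈ D, S ⊆ G.edgeSet ∧ EvenEdgeSet S) ∧
  ∀ e ∈ G.edgeSet, D.countP (fun S => e ∈ S) = 2

/-- The set A contains (the vertices of) a cycle of G. -/
def HasCycleIn (G : SimpleGraph V) (A : Set V) : Prop :=
  ∃ C : G.Subgraph, IsCycleSub C ∧ C.verts ⊆ A

/-- The edges of G crossing between A and its complement. -/
def cutEdges (G : SimpleGraph V) (A : Set V) : Set (Sym2 V) :=
  {e ∈ G.edgeSet | ∃ x ∈ A, ∃ y ∉ A, e = s(x, y)}

/-- Cyclically k-edge-connected: every edge cut separating two cycles has at least k edges. -/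
def CyclEdgeConn (G : SimpleGraph V) (k : ℕ) : Prop :=
  ∀ A : Set V, HasCycleIn G A → HasCycleIn G Aᶜ → k ≤ (cutEdges G A).ncard

/-- A snark: an uncolourable cyclically 4-edge-connected cubic graph with girth at least 5. -/
def IsSnark (G : SimpleGraph V) : Prop :=
  IsCubic G ∧ ¬ Colourable3 G ∧ CyclEdgeConn G 4 ∧ 5 ≤ G.girth

/-- The edge-insertion operation applied to the edges ab and cd of G: subdivide each with a
new vertex (u = inr 0, v = inr 1) and join the two new vertices by an edge. -/
def edgeInsertion (G : SimpleGraph V) (a b c d : V) : SimpleGraph (V ⊕ Fin 2) :=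
  SimpleGraph.fromEdgeSet
    ((Sym2.map Sum.inl '' (G.edgeSet \ {s(a, b), s(c, d)})) ∪
      {s(Sum.inl a, Sum.inr 0), s(Sum.inr 0, Sum.inl b),
       s(Sum.inl c, Sum.inr 1), s(Sum.inr 1, Sum.inl d),
       s(Sum.inr 0, Sum.inr 1)})

/-- A permutation graph: a cubic graph with a 2-factor consisting of two induced cycles. -/
def IsPermutationGraph (G : SimpleGraph V) : Prop :=
  IsCubic G ∧ ∃ C₁ C₂ : G.Subgraph, IsCycleSub C₁ ∧ IsCycleSub C₂ ∧
    C₁.IsInduced ∧ C₂.IsInduced ∧ Disjoint C₁.verts C₂.verts ∧ IsTwoFactor (C₁ ⊔ C₂)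

/-- The total weight of the edge cut determined by A. -/
noncomputable def cutWeight (G : SimpleGraph V) (w : Sym2 V → ℕ) (A : Set V) : ℕ :=
  ∑ᶠ e ∈ cutEdges G A, w e

/-- An eulerian (1,2)-weight: each edge gets weight 1 or 2 and every edge cut has even weight. -/
def IsEulerianWeight (G : SimpleGraph V) (w : Sym2 V → ℕ) : Prop :=
  (∀ e ∈ G.edgeSet, w e = 1 ∨ w e = 2) ∧ ∀ A : Set V, Even (cutWeight G w A)

/-- A compatible cycle cover of (G, w): each edge e lies in exactly w(e) of the cycles. -/
def IsCompatibleCycleCover (G : SimpleGraph V) (w : Sym2 V → ℕ)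
    (D : Multiset G.Subgraph) : Prop :=
  (∀ C ∈ D, IsCycleSub C) ∧
  ∀ e ∈ G.edgeSet, D.countP (fun C => e ∈ C.edgeSet) = w e


/-- In characteristic two a symmetric array with zero diagonal sums to zero. -/
theorem sum_symm_zero [Fintype V] {M : Type*} [AddCommMonoid M] (h2 : ∀ x : M, x + x = 0)
    (f : V → V → M) (hs : ∀ v w, f v w = f w v) (hd : ∀ v, f v v = 0) :
    ∑ v, ∑ w, f v w = 0 := by
  rw [← Fintype.sum_prod_type']
  refine Finset.sum_involution (fun p _ => (p.2, p.1)) ?_ ?_ ?_ ?_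
  · rintro ⟨a, b⟩ _
    simp only
    rw [hs b a, h2]
  · rintro ⟨a, b⟩ _ h1 h3
    simp only [Prod.mk.injEq] at h3
    apply h1
    simp only [h3.1]
    exact hd _
  · simp
  · simp

theorem boundary_pair [Fintype V] {M : Type*} [AddCommGroup M] (h2 : ∀ x : M, x + x = 0)
    (J : SimpleGraph V) (c : M) {u v : V} (p : J.Walk u v) :
    ∃ t : Sym2 V → M, (∀ e ∉ J.edgeSet, t e = 0) ∧
      ∀ x, ∑ w, t s(x, w) = (if x = u then c else 0) + (if x = v then c else 0) := by
  induction p with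
  | nil =>
    refine ⟨fun _ => 0, by simp, fun x => ?_⟩
    simp [h2]
  | @cons u v w h p ih =>
    obtain ⟨t, ht, hb⟩ := ih
    refine ⟨fun e => t e + if e = s(u, v) then c else 0, ?_, ?_⟩
    · intro e he
      simp only
      rw [ht e he, if_neg, add_zero]
      rintro rfl
      exact he h
    · intro x
      have hne : u ≠ v := h.ne
      have key : ∑ w, (if s(x, w) = s(u, v) then c else 0) =
          (if x = u then c else 0) + (if x = v then c else 0) := by
        by_cases hxu : x = u
        · subst hxu
          rw [if_pos rfl, if_neg hne, add_zero, Finset.sum_eq_single v]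
          · simp
          · intro b _ hb
            rw [if_neg]
            simp [hb, hne]
          · simp
        · by_cases hxv : x = v
          · subst hxv
            rw [if_pos rfl, if_neg hxu, zero_add, Finset.sum_eq_single u]
            · simp [Sym2.eq_swap]
            · intro b _ hb
              rw [if_neg]
              simp [hb, hxu]
            · simp
          · rw [if_neg hxu, if_neg hxv, add_zero]
            apply Finset.sum_eq_zero
            intro b _
            rw [if_neg]
            simp [hxu, hxv]
      rw [Finset.sum_add_distrib, hb, key]
      have := h2 (if x = v then c else 0)
      calc _ = (if x = u then c else 0) + (if x = w then c else 0) +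
          ((if x = v then c else 0) + (if x = v then c else 0)) := by abel
        _ = _ := by rw [this, add_zero]

theorem boundary_exists [Fintype V] {M : Type*} [AddCommGroup M] (h2 : ∀ x : M, x + x = 0)
    (J : SimpleGraph V) (τ : V → M)
    (hτ : ∀ K : J.ConnectedComponent, ∑ v, (if J.connectedComponentMk v = K then τ v else 0) = 0) :
    ∃ t : Sym2 V → M, (∀ e ∉ J.edgeSet, t e = 0) ∧ ∀ x, ∑ w, t s(x, w) = τ x := by
  let root : J.ConnectedComponent → V := fun K => K.out
  have hroot : ∀ K, J.connectedComponentMk (root K) = K := fun K => K.out_eq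
  have hr : ∀ v, J.Reachable v (root (J.connectedComponentMk v)) := fun v =>
    SimpleGraph.ConnectedComponent.exact (hroot _).symm
  choose t ht hb using fun v => boundary_pair h2 J (τ v) (hr v).some
  refine ⟨fun e => ∑ v, t v e, ?_, ?_⟩
  · intro e he
    exact Finset.sum_eq_zero fun v _ => ht v e he
  · intro x
    rw [Finset.sum_comm]
    simp_rw [hb, Finset.sum_add_distrib]
    rw [Finset.sum_ite_eq]
    simp only [Finset.mem_univ, if_true]
    have : ∑ v, (if x = root (J.connectedComponentMk v) then τ v else 0) = 0 := by
      by_cases h : x = root (J.connectedComponentMk x)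
      · refine Eq.trans ?_ (hτ (J.connectedComponentMk x))
        apply Finset.sum_congr rfl
        intro v _
        refine if_congr ?_ rfl rfl
        constructor
        · intro h1
          rw [h1, hroot]
        · intro h1
          rw [h1, ← h]
      · apply Finset.sum_eq_zero
        intro v _
        rw [if_neg]
        intro h1
        apply h
        conv_rhs => rw [h1, hroot]
        exact h1
    rw [this, add_zero]

theorem f4_two {F : Type*} [Field F] [Fintype F] (h4 : Fintype.card F = 4) (x : F) :
    x + x = 0 := by
  have h : ((4 : ℕ) : F) = 0 := by
    rw [← h4]
    exact Nat.cast_card_eq_zero F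
  have h22 : (2 : F) * 2 = 0 := by
    rw [← h]
    norm_num
  have h2 : (2 : F) = 0 := by
    rcases mul_eq_zero.1 h22 with h | h <;> exact h
  rw [← two_mul, h2, zero_mul]

theorem f4_pow {F : Type*} [Field F] [Fintype F] (h4 : Fintype.card F = 4) (x : F) :
    x ^ 4 = x := by
  rw [← h4]
  exact FiniteField.pow_card x

theorem f4_sq_add {F : Type*} [Field F] [Fintype F] (h4 : Fintype.card F = 4) (x y : F) :
    (x + y) ^ 2 = x ^ 2 + y ^ 2 := by
  have := f4_two h4 (x * y)
  linear_combination this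

/-- The Frobenius map. -/
def frob4 {F : Type*} [Field F] [Fintype F] (h4 : Fintype.card F = 4) : F →+* F where
  toFun x := x ^ 2
  map_one' := by simp
  map_mul' x y := by ring
  map_zero' := by simp
  map_add' x y := f4_sq_add h4 x y

section
variable {ι : Type*} [Fintype ι] {F : Type*} [Field F] [Fintype F]

/-- The matrix perturbed by a 0/1 diagonal. -/
noncomputable def pert (M : Matrix ι ι F) (d : ι → Bool) : Matrix ι ι F :=
  M + Matrix.diagonal (fun i => if d i then 1 else 0)

theorem sum_det_pert (h4 : Fintype.card F = 4) (M : Matrix ι ι F) :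
    ∑ d, (pert M d).det = 1 := by
  simp_rw [Matrix.det_apply]
  rw [Finset.sum_comm]
  rw [Finset.sum_eq_single (1 : Equiv.Perm ι)]
  · simp only [Equiv.Perm.sign_one, one_smul, Equiv.Perm.coe_one, id_eq]
    have := Finset.prod_univ_sum (fun _ : ι => (Finset.univ : Finset Bool))
      (fun i b => M i i + if b then (1 : F) else 0)
    rw [Fintype.piFinset_univ] at this
    simp only [pert, Matrix.add_apply, Matrix.diagonal_apply_eq]
    rw [← this]
    apply Finset.prod_eq_one
    intro i _
    simp only [Fintype.univ_bool, Finset.mem_singleton, Bool.true_eq_false, not_false_eq_true,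
      Finset.sum_insert, if_true, Finset.sum_singleton, Bool.false_eq_true, if_false]
    linear_combination f4_two h4 (M i i)
  · intro σ _ hσ
    rw [← Finset.smul_sum]
    have := Finset.prod_univ_sum (fun _ : ι => (Finset.univ : Finset Bool))
      (fun i b => M (σ i) i + if σ i = i then (if b then (1 : F) else 0) else 0)
    rw [Fintype.piFinset_univ] at this
    have h3 : ∀ d : ι → Bool, ∏ i, pert M d (σ i) i =
        ∏ i, (M (σ i) i + if σ i = i then (if d i then (1 : F) else 0) else 0) := by
      intro d
      apply Finset.prod_congr rfl
      intro i _
      simp only [pert, Matrix.add_apply, Matrix.diagonal_apply]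
      by_cases h : σ i = i <;> simp [h]
    simp_rw [h3]
    rw [← this]
    obtain ⟨i, hi⟩ : ∃ i, σ i ≠ i := by
      by_contra hcon
      push Not at hcon
      exact hσ (Equiv.ext hcon)
    rw [Finset.prod_eq_zero (Finset.mem_univ i), smul_zero]
    simp only [hi, if_false, add_zero, Fintype.sum_bool]
    exact f4_two h4 _
  · simp

theorem det_pert (h4 : Fintype.card F = 4) (M : Matrix ι ι F)
    (hM : ∀ i j, M j i = (M i j) ^ 2) (d : ι → Bool) :
    (pert M d).det = 0 ∨ (pert M d).det = 1 := by
  have h1 : (frob4 h4).mapMatrix (pert M d) = (pert M d).transpose := by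
    ext i j
    simp only [pert, RingHom.mapMatrix_apply, Matrix.map_apply, Matrix.transpose_apply,
      Matrix.add_apply, map_add, Matrix.diagonal_apply]
    congr 1
    · exact (hM i j).symm
    · by_cases h : i = j
      · subst h
        cases d i <;> simp
      · simp [h, Ne.symm h]
  have h2 := congrArg Matrix.det h1
  rw [← RingHom.map_det, Matrix.det_transpose] at h2
  have h3 : (pert M d).det ^ 2 = (pert M d).det := h2
  by_cases h : (pert M d).det = 0
  · exact Or.inl h
  · right
    apply mul_left_cancel₀ h
    linear_combination h3

theorem sum_ker_pert (h4 : Fintype.card F = 4) (M : Matrix ι ι F)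
    (hM : ∀ i j, M j i = (M i j) ^ 2) (d : ι → Bool) :
    ∑ x : ι → F, (if (pert M d).mulVec x = 0 then (1 : F) else 0) = (pert M d).det := by
  rcases det_pert h4 M hM d with h | h
  · rw [h]
    obtain ⟨x0, hx0, hx⟩ := Matrix.exists_mulVec_eq_zero_iff.2 h
    refine Finset.sum_involution (fun x _ => x + x0) ?_ ?_ ?_ ?_
    · intro x _
      rw [Matrix.mulVec_add, hx, add_zero]
      exact f4_two h4 _
    · intro x _ _ h5
      exact hx0 (by simpa using h5)
    · simp
    · intro x _
      funext i
      simp only [Pi.add_apply]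
      linear_combination f4_two h4 (x0 i)
  · rw [h, Finset.sum_eq_single 0]
    · simp
    · intro x _ hx
      rw [if_neg]
      intro h5
      have := Matrix.exists_mulVec_eq_zero_iff.1 ⟨x, hx, h5⟩
      rw [h] at this
      exact one_ne_zero this
    · simp

theorem hermitian_ker (h4 : Fintype.card F = 4) (M : Matrix ι ι F)
    (hM : ∀ i j, M j i = (M i j) ^ 2) :
    ∃ x : ι → F, ∃ d : ι → Bool, (∀ i, x i ≠ 0) ∧
      ∀ i, ∑ j, M i j * x j + (if d i then x i else 0) = 0 := by
  by_contra hcon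
  have htot : ∑ d : ι → Bool, ∑ x : ι → F,
      (if (pert M d).mulVec x = 0 then (1 : F) else 0) = 1 := by
    simp_rw [sum_ker_pert h4 M hM]
    exact sum_det_pert h4 M
  have hval : ∀ (d : ι → Bool) (x : ι → F) (i : ι), (pert M d).mulVec x i =
      ∑ j, M i j * x j + (if d i then x i else 0) := by
    intro d x i
    simp only [pert, Matrix.add_mulVec, Pi.add_apply, Matrix.mulVec_diagonal]
    congr 1
    split_ifs <;> simp
  rw [Finset.sum_comm, Finset.sum_eq_zero] at htot
  · exact zero_ne_one htot
  intro x _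
  by_cases hx : ∀ i, x i ≠ 0
  · apply Finset.sum_eq_zero
    intro d _
    rw [if_neg]
    intro h
    refine hcon ⟨x, d, hx, fun i => ?_⟩
    rw [← hval, h]
    rfl
  · push Not at hx
    obtain ⟨r, hr⟩ := hx
    refine Finset.sum_involution (fun d _ => Function.update d r (!(d r))) ?_ ?_ ?_ ?_
    · intro d _
      have : (pert M (Function.update d r (!(d r)))).mulVec x = (pert M d).mulVec x := by
        funext i
        rw [hval, hval]
        by_cases h : i = r
        · subst h
          simp [hr]
        · simp [h]
      rw [this]
      exact f4_two h4 _
    · intro d _ _ h5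
      have := congrFun h5 r
      simp at this
    · simp
    · intro d _
      simp
end

/-- The trace to the prime field. -/
def tr4 {F : Type*} [Field F] (x : F) : F := x + x ^ 2

section
variable {F : Type*} [Field F] [Fintype F]

theorem tr4_add (h4 : Fintype.card F = 4) (x y : F) : tr4 (x + y) = tr4 x + tr4 y := by
  simp only [tr4, f4_sq_add h4]
  ring

theorem tr4_sum (h4 : Fintype.card F = 4) {ι : Type*} (s : Finset ι) (f : ι → F) :
    tr4 (∑ i ∈ s, f i) = ∑ i ∈ s, tr4 (f i) := by
  induction s using Finset.induction_on with
  | empty => simp [tr4]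
  | insert a s ha ih => rw [Finset.sum_insert ha, Finset.sum_insert ha, tr4_add h4, ih]

theorem sq_sum4 (h4 : Fintype.card F = 4) {ι : Type*} (s : Finset ι) (f : ι → F) :
    (∑ i ∈ s, f i) ^ 2 = ∑ i ∈ s, (f i) ^ 2 :=
  map_sum (frob4 h4) f s

theorem tr4_idem (h4 : Fintype.card F = 4) (x : F) : (tr4 x) ^ 2 = tr4 x := by
  simp only [tr4, f4_sq_add h4]
  have := f4_pow h4 x
  linear_combination this

theorem idem_cases {x : F} (h : x ^ 2 = x) : x = 0 ∨ x = 1 := by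
  have : x * (x - 1) = 0 := by linear_combination h
  rcases mul_eq_zero.1 this with h | h
  · exact Or.inl h
  · exact Or.inr (sub_eq_zero.1 h)

theorem cube4 (h4 : Fintype.card F = 4) {x : F} (h : x ≠ 0) : x ^ 3 = 1 := by
  apply mul_left_cancel₀ h
  linear_combination f4_pow h4 x

theorem exists_omega (h4 : Fintype.card F = 4) : ∃ ω : F, tr4 ω = 1 := by
  have : ∃ ω : F, ω ∉ ({0, 1} : Finset F) := by
    by_contra hcon
    push Not at hcon
    have h1 : (Finset.univ : Finset F) ⊆ {0, 1} := fun x _ => hcon x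
    have h2 := Finset.card_le_card h1
    rw [Finset.card_univ, h4] at h2
    have h3 : ({0, 1} : Finset F).card ≤ 2 := Finset.card_le_two
    omega
  obtain ⟨ω, hω⟩ := this
  refine ⟨ω, ?_⟩
  rcases idem_cases (tr4_idem h4 ω) with h | h
  · exfalso
    apply hω
    have h5 : ω ^ 2 = ω := by
      simp only [tr4] at h
      linear_combination h - f4_two h4 ω
    rcases idem_cases h5 with h | h <;> simp [h]
  · exact h

theorem tr4_eq_zero (h4 : Fintype.card F = 4) {x : F} : tr4 x = 0 ↔ x = 0 ∨ x = 1 := by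
  constructor
  · intro h
    apply idem_cases
    simp only [tr4] at h
    linear_combination h - f4_two h4 x
  · rintro (rfl | rfl)
    · simp [tr4]
    · simpa [tr4] using f4_two h4 1

theorem even_of_cast (h4 : Fintype.card F = 4) {n : ℕ} (h : (n : F) = 0) : Even n := by
  by_contra hodd
  rw [Nat.not_even_iff_odd] at hodd
  obtain ⟨k, rfl⟩ := hodd
  have : (1 : F) = 0 := by
    push_cast at h
    linear_combination h - f4_two h4 (k : F)
  exact one_ne_zero this

theorem cast_idem (h4 : Fintype.card F = 4) (n : ℕ) : (n : F) ^ 2 = n := by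
  induction n with
  | zero => simp
  | succ n ih =>
    push_cast
    rw [f4_sq_add h4, ih]
    simp

theorem card_tr4 (h4 : Fintype.card F = 4) {h : F} (hh : h ≠ 0) {t : F} (ht : t ^ 2 = t) :
    (Finset.univ.filter fun z => tr4 (h ^ 2 * z) = t).card = 2 := by
  have h3 := cube4 h4 hh
  have e0 : (Finset.univ.filter fun z => tr4 (h ^ 2 * z) = 0).card = 2 := by
    have : (Finset.univ.filter fun z => tr4 (h ^ 2 * z) = 0) = {0, h} := by
      ext z
      simp only [Finset.mem_filter, Finset.mem_univ, true_and, tr4_eq_zero h4,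
        Finset.mem_insert, Finset.mem_singleton]
      constructor
      · rintro (h1 | h1)
        · left
          simpa [hh] using h1
        · right
          linear_combination (-z) * h3 + h * h1
      · rintro (rfl | rfl)
        · simp
        · right
          linear_combination h3
    rw [this, Finset.card_pair hh.symm]
  rcases idem_cases ht with rfl | rfl
  · exact e0
  · have h6 := Finset.card_filter_add_card_filter_not (s := (Finset.univ : Finset F))
      (fun z => tr4 (h ^ 2 * z) = 0)
    rw [e0, Finset.card_univ, h4] at h6
    have : (Finset.univ.filter fun z => tr4 (h ^ 2 * z) = 1) =
        (Finset.univ.filter fun z => ¬ tr4 (h ^ 2 * z) = 0) := by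
      ext z
      simp only [Finset.mem_filter, Finset.mem_univ, true_and]
      rcases idem_cases (tr4_idem h4 (h ^ 2 * z)) with h7 | h7 <;> simp [h7]
    rw [this]
    omega

theorem local_even (h4 : Fintype.card F = 4) {h : F} (hh : h ≠ 0) (a z : F) :
    (if a = z then (1 : F) else 0) + (if a + h = z then (1 : F) else 0) +
      (if tr4 (h ^ 2 * z) = tr4 (h ^ 2 * a) then (1 : F) else 0) = 0 := by
  have h3 := cube4 h4 hh
  have key : tr4 (h ^ 2 * z) = tr4 (h ^ 2 * a) ↔ (a = z ∨ a + h = z) := by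
    have h5 : tr4 (h ^ 2 * (z + a)) = tr4 (h ^ 2 * z) + tr4 (h ^ 2 * a) := by
      rw [mul_add, tr4_add h4]
    have h6 : tr4 (h ^ 2 * z) = tr4 (h ^ 2 * a) ↔ tr4 (h ^ 2 * (z + a)) = 0 := by
      rw [h5]
      have := f4_two h4 (tr4 (h ^ 2 * a))
      constructor
      · intro h
        rw [h, this]
      · intro h
        linear_combination h - this
    rw [h6, tr4_eq_zero h4]
    have h7 := f4_two h4 a
    constructor
    · rintro (h1 | h1)
      · left
        have : z + a = 0 := by simpa [hh] using h1
        linear_combination h7 - this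
      · right
        have : z + a = h := by linear_combination (-(z + a)) * h3 + h * h1
        linear_combination h7 - this
    · rintro (h1 | h1)
      · left
        rw [← h1, h7, mul_zero]
      · right
        rw [← h1]
        linear_combination h3 + h ^ 2 * h7
  have h1 := f4_two h4 (1 : F)
  by_cases ha : a = z
  · have hb : a + h ≠ z := by
      rw [ha]
      simpa using hh
    rw [if_pos ha, if_neg hb, if_pos (key.2 (Or.inl ha)), add_zero, h1]
  · by_cases hb : a + h = z
    · rw [if_neg ha, if_pos hb, if_pos (key.2 (Or.inr hb)), zero_add, h1]
    · rw [if_neg ha, if_neg hb, if_neg, add_zero, add_zero]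
      rw [key]
      tauto

theorem idem_ind (h4 : Fintype.card F = 4) {a b : F} (ha : a ^ 2 = a) (hb : b ^ 2 = b) :
    (if a = b then (1 : F) else 0) = 1 + a + b := by
  have h1 := f4_two h4 (1 : F)
  rcases idem_cases ha with rfl | rfl <;> rcases idem_cases hb with rfl | rfl <;> simp [h1]
end

theorem adj_of_ne {F : Type*} [Zero F] {J : SimpleGraph V} {g : Sym2 V → F}
    (hg : ∀ e ∉ J.edgeSet, g e = 0) {v w : V} (h : g s(v, w) ≠ 0) : J.Adj v w := by
  by_contra hn
  exact h (hg _ hn)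

/-- Sums of boundaries over connected components vanish. -/
theorem comp_boundary_zero [Fintype V] {M : Type*} [AddCommGroup M] (h2 : ∀ x : M, x + x = 0)
    (J : SimpleGraph V) (g : Sym2 V → M) (hg : ∀ e ∉ J.edgeSet, g e = 0)
    (K : J.ConnectedComponent) :
    ∑ v, (if J.connectedComponentMk v = K then ∑ w, g s(v, w) else 0) = 0 := by
  have h := sum_symm_zero h2
    (fun v w => if J.connectedComponentMk v = K then g s(v, w) else 0) ?_ ?_
  · refine Eq.trans ?_ h
    apply Finset.sum_congr rfl
    intro v _
    split_ifs <;> simp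
  · intro v w
    by_cases h : g s(v, w) = 0
    · simp only [Sym2.eq_swap (a := w) (b := v), h, ite_self]
    · have hadj := adj_of_ne hg h
      have : J.connectedComponentMk v = J.connectedComponentMk w :=
        SimpleGraph.ConnectedComponent.sound hadj.reachable
      simp only [Sym2.eq_swap (a := w) (b := v), this]
  · intro v
    have : g s(v, v) = 0 := hg _ (by simp)
    simp [this]

section
variable {F : Type*} [Field F] [Fintype F]

/-- Family of edge labellings of the cycle, one per component of the complement. -/
theorem exists_family [Fintype V] (h4 : Fintype.card F = 4)
    (A J : SimpleGraph V) (Cs : Set V) (n1 n2 l : V → V)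
    (hn : ∀ v ∈ Cs, n1 v ≠ n2 v) (hA : ∀ v ∈ Cs, ∀ w, A.Adj v w ↔ w = n1 v ∨ w = n2 v)
    (hA0 : ∀ v ∉ Cs, ∀ w, ¬ A.Adj v w)
    (hAc : ∀ u ∈ Cs, ∀ v ∈ Cs, A.Reachable u v)
    (hl : ∀ v ∈ Cs, ∀ w, J.Adj v w ↔ w = l v)
    (g : Sym2 V → F) (hg : ∀ e, g e ≠ 0 ↔ e ∈ J.edgeSet)
    (hg0 : ∀ v ∉ Cs, ∑ w, g s(v, w) = 0) (K : J.ConnectedComponent) :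
    ∃ s : Sym2 V → F, (∀ e ∉ A.edgeSet, s e = 0) ∧ ∀ v ∈ Cs,
      s s(v, n1 v) + s s(v, n2 v) =
        if J.connectedComponentMk v = K then g s(v, l v) else 0 := by
  have hgz : ∀ e ∉ J.edgeSet, g e = 0 := by
    intro e he
    by_contra h
    exact he ((hg e).1 h)
  have hb : ∀ v ∈ Cs, ∑ w, g s(v, w) = g s(v, l v) := by
    intro v hv
    apply Finset.sum_eq_single (l v)
    · intro w _ hw
      apply hgz
      rw [SimpleGraph.mem_edgeSet, hl v hv]
      exact hw
    · simp
  have hB : ∀ B : A.ConnectedComponent, ∑ v, (if A.connectedComponentMk v = B then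
      (if J.connectedComponentMk v = K then ∑ w, g s(v, w) else 0) else 0) = 0 := by
    intro B
    have htot := comp_boundary_zero (f4_two h4) J g hgz K
    obtain ⟨r, rfl⟩ := B.exists_rep
    change ∑ v, (if A.connectedComponentMk v = A.connectedComponentMk r then _ else 0) = 0
    by_cases hr : r ∈ Cs
    · refine Eq.trans ?_ htot
      apply Finset.sum_congr rfl
      intro v _
      by_cases hv : v ∈ Cs
      · rw [if_pos (SimpleGraph.ConnectedComponent.sound (hAc v hv r hr))]
      · rw [hg0 v hv]
        simp
    · apply Finset.sum_eq_zero
      intro v _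
      by_cases hv : v ∈ Cs
      · rw [if_neg]
        intro h
        obtain ⟨p⟩ := SimpleGraph.ConnectedComponent.exact h.symm
        cases p with
        | nil => exact hr hv
        | cons h p => exact hA0 r hr _ h
      · rw [hg0 v hv]
        simp
  obtain ⟨s, hs0, hs⟩ := boundary_exists (f4_two h4) A
    (fun v => if J.connectedComponentMk v = K then ∑ w, g s(v, w) else 0) hB
  · refine ⟨s, hs0, ?_⟩
    intro v hv
    have := hs v
    rw [hb v hv] at this
    rw [← this]
    symm
    apply Finset.sum_eq_add (n1 v) (n2 v) (hn v hv)
    · intro w _ hw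
      apply hs0
      rw [SimpleGraph.mem_edgeSet, hA v hv]
      tauto
    · simp
    · simp

/-- The hermitian pairing identity. -/
theorem pairing [Fintype V] (h4 : Fintype.card F = 4)
    (A : SimpleGraph V) (Cs : Set V) (n1 n2 : V → V)
    (hn : ∀ v ∈ Cs, n1 v ≠ n2 v) (hA : ∀ v ∈ Cs, ∀ w, A.Adj v w ↔ w = n1 v ∨ w = n2 v)
    (hA0 : ∀ v ∉ Cs, ∀ w, ¬ A.Adj v w) (s s' : Sym2 V → F)
    (hs0 : ∀ e ∉ A.edgeSet, s e = 0) (a a' : V → F)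
    (hs : ∀ v ∈ Cs, s s(v, n1 v) + s s(v, n2 v) = a v)
    (hs' : ∀ v ∈ Cs, s' s(v, n1 v) + s' s(v, n2 v) = a' v)
    (ha : ∀ v ∉ Cs, a v = 0) (ha' : ∀ v ∉ Cs, a' v = 0) :
    ∑ v, a' v * (s s(v, n1 v)) ^ 2 + ∑ v, (a v) ^ 2 * s' s(v, n1 v) +
      ∑ v, (a v) ^ 2 * a' v = 0 := by
  have h := sum_symm_zero (f4_two h4) (fun v w => (s s(v, w)) ^ 2 * s' s(v, w)) ?_ ?_
  · refine Eq.trans ?_ h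
    rw [← Finset.sum_add_distrib, ← Finset.sum_add_distrib]
    apply Finset.sum_congr rfl
    intro v _
    by_cases hv : v ∈ Cs
    · rw [Finset.sum_eq_add (n1 v) (n2 v) (hn v hv)]
      · rw [← hs v hv, ← hs' v hv]
        generalize s s(v, n1 v) = x
        generalize s s(v, n2 v) = x2
        generalize s' s(v, n1 v) = y
        generalize s' s(v, n2 v) = y2
        linear_combination (x^2 + x * x2 + x2 ^ 2 + x * x2) * (f4_two h4 y) +
          (x ^ 2 + x * x2) * (f4_two h4 y2)
      · intro w _ hw
        rw [hs0]
        · simp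
        · rw [SimpleGraph.mem_edgeSet, hA v hv]
          tauto
      · simp
      · simp
    · rw [ha v hv, ha' v hv, Finset.sum_eq_zero]
      · simp
      · intro w _
        rw [hs0]
        · simp
        · exact hA0 v hv w
  · intro v w
    simp only [Sym2.eq_swap (a := w) (b := v)]
  · intro v
    rw [hs0]
    · simp
    · simp
end

section
variable {F : Type*} [Field F] [Fintype F]

/-- Choice of scalars for the components and of the 0/1 twist on the complement. -/
theorem exists_twist [Fintype V] (h4 : Fintype.card F = 4)
    (A J : SimpleGraph V) (Cs : Set V) (n1 n2 l : V → V)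
    (hn : ∀ v ∈ Cs, n1 v ≠ n2 v) (hA : ∀ v ∈ Cs, ∀ w, A.Adj v w ↔ w = n1 v ∨ w = n2 v)
    (hA0 : ∀ v ∉ Cs, ∀ w, ¬ A.Adj v w)
    (hAc : ∀ u ∈ Cs, ∀ v ∈ Cs, A.Reachable u v)
    (hl : ∀ v ∈ Cs, ∀ w, J.Adj v w ↔ w = l v)
    (g : Sym2 V → F) (hg : ∀ e, g e ≠ 0 ↔ e ∈ J.edgeSet)
    (hg0 : ∀ v ∉ Cs, ∑ w, g s(v, w) = 0) :
    ∃ (s g' t : Sym2 V → F), (∀ e, g' e ≠ 0 ↔ e ∈ J.edgeSet) ∧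
      (∀ v ∉ Cs, ∑ w, g' s(v, w) = 0) ∧ (∀ e ∉ J.edgeSet, t e = 0) ∧ (∀ e, t e ^ 2 = t e) ∧
      (∀ v ∈ Cs, s s(v, n1 v) + s s(v, n2 v) = g' s(v, l v)) ∧
      (∀ v ∈ Cs, t s(v, l v) = tr4 (g' s(v, l v) ^ 2 * s s(v, n1 v))) ∧
      (∀ v ∉ Cs, ∑ w, t s(v, w) = ∑ w, if J.Adj v w then 1 else 0) := by
  choose sK hsK0 hsK using
    exists_family h4 A J Cs n1 n2 l hn hA hA0 hAc hl g hg hg0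
  have hgz : ∀ e ∉ J.edgeSet, g e = 0 := by
    intro e he
    by_contra h
    exact he ((hg e).1 h)
  let gK : J.ConnectedComponent → V → F := fun K v =>
    if v ∈ Cs then (if J.connectedComponentMk v = K then g s(v, l v) else 0) else 0
  have hgKin : ∀ K, ∀ v ∈ Cs,
      gK K v = if J.connectedComponentMk v = K then g s(v, l v) else 0 := by
    intro K v hv
    simp only [gK, if_pos hv]
  have hgKout : ∀ K, ∀ v ∉ Cs, gK K v = 0 := by
    intro K v hv
    simp only [gK, if_neg hv]
  have hpair : ∀ K K', _ := fun K K' => pairing h4 A Cs n1 n2 hn hA hA0 (sK K) (sK K')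
    (hsK0 K) (gK K) (gK K') (fun v hv => by rw [hsK K v hv, hgKin K v hv])
    (fun v hv => by rw [hsK K' v hv, hgKin K' v hv]) (hgKout K) (hgKout K')
  let m : J.ConnectedComponent → J.ConnectedComponent → F := fun K K' =>
    ∑ v, (gK K v) ^ 2 * sK K' s(v, n1 v)
  have hmsq : ∀ K K', (m K K') ^ 2 = ∑ v, gK K v * (sK K' s(v, n1 v)) ^ 2 := by
    intro K K'
    simp only [m]
    rw [sq_sum4 h4]
    apply Finset.sum_congr rfl
    intro v _
    rw [mul_pow, ← pow_mul, f4_pow h4]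
  have hherm : ∀ K K', K ≠ K' → m K' K = (m K K') ^ 2 := by
    intro K K' hne
    have h1 := hpair K' K
    have h2 : ∑ v, (gK K' v) ^ 2 * gK K v = 0 := by
      apply Finset.sum_eq_zero
      intro v _
      by_cases hv : v ∈ Cs
      · rw [hgKin _ v hv, hgKin _ v hv]
        by_cases h : J.connectedComponentMk v = K
        · have : J.connectedComponentMk v ≠ K' := by
            rw [h]
            exact hne
          simp [this]
        · simp [h]
      · simp [hgKout _ v hv]
    rw [h2, add_zero, ← hmsq] at h1
    have h3 := f4_two h4 ((m K K') ^ 2)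
    change (m K K') ^ 2 + m K' K = 0 at h1
    linear_combination h1 - h3
  have hself : ∀ K, tr4 (m K K) =
      ∑ v, if J.connectedComponentMk v = K then (if v ∈ Cs then (1 : F) else 0) else 0 := by
    intro K
    have h1 := hpair K K
    rw [← hmsq] at h1
    change (m K K) ^ 2 + m K K + _ = 0 at h1
    have h2 : ∑ v, (gK K v) ^ 2 * gK K v =
        ∑ v, if J.connectedComponentMk v = K then (if v ∈ Cs then (1 : F) else 0) else 0 := by
      apply Finset.sum_congr rfl
      intro v _
      by_cases hv : v ∈ Cs
      · rw [hgKin _ v hv]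
        by_cases h : J.connectedComponentMk v = K
        · have h5 : g s(v, l v) ≠ 0 := by
            rw [hg, SimpleGraph.mem_edgeSet, hl v hv]
          simp only [h, hv, if_true]
          linear_combination cube4 h4 h5
        · simp [h]
      · simp [hgKout _ v hv, hv]
    rw [h2] at h1
    have h3 := f4_two h4
      (∑ v, if J.connectedComponentMk v = K then (if v ∈ Cs then (1 : F) else 0) else 0)
    simp only [tr4]
    linear_combination h1 - h3
  obtain ⟨x, d, hx, hker⟩ := hermitian_ker h4
    (Matrix.of fun K K' => if K = K' then 0 else m K K') (by
      intro K K'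
      simp only [Matrix.of_apply]
      by_cases h : K = K'
      · simp [h]
      · rw [if_neg h, if_neg (Ne.symm h)]
        exact hherm K K' h)
  simp only [Matrix.of_apply] at hker
  -- scaled flow
  let g' : Sym2 V → F := fun e => x (J.connectedComponentMk e.out.1) * g e
  have hg' : ∀ v w, g' s(v, w) = x (J.connectedComponentMk v) * g s(v, w) := by
    intro v w
    by_cases h : g s(v, w) = 0
    · simp only [g', h, mul_zero]
    · have hadj := adj_of_ne hgz h
      have h1 : J.connectedComponentMk v = J.connectedComponentMk w :=
        SimpleGraph.ConnectedComponent.sound hadj.reachable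
      have h2 : J.connectedComponentMk (s(v, w) : Sym2 V).out.1 = J.connectedComponentMk v := by
        have := Sym2.out_fst_mem s(v, w)
        rw [Sym2.mem_iff] at this
        rcases this with h3 | h3
        · rw [h3]
        · rw [h3, h1]
      simp only [g', h2]
  let s : Sym2 V → F := fun e => ∑ K, x K * sK K e
  have hs : ∀ v ∈ Cs, s s(v, n1 v) + s s(v, n2 v) = g' s(v, l v) := by
    intro v hv
    simp only [s]
    rw [← Finset.sum_add_distrib, hg', Finset.sum_eq_single (J.connectedComponentMk v)]
    · rw [← mul_add, hsK _ v hv, if_pos rfl]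
    · intro K _ hK
      rw [← mul_add, hsK _ v hv, if_neg (Ne.symm hK), mul_zero]
    · simp
  let τ : V → F := fun v => if v ∈ Cs then tr4 (g' s(v, l v) ^ 2 * s s(v, n1 v))
    else ∑ w, if J.Adj v w then 1 else 0
  have hτi : ∀ v, (τ v) ^ 2 = τ v := by
    intro v
    simp only [τ]
    split_ifs
    · exact tr4_idem h4 _
    · rw [Finset.sum_boole]
      exact cast_idem h4 _
  have hdeg : ∀ K, ∑ v, (if J.connectedComponentMk v = K then
      ∑ w, (if J.Adj v w then (1 : F) else 0) else 0) = 0 := by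
    intro K
    have := comp_boundary_zero (f4_two h4) J (fun e => if e ∈ J.edgeSet then (1 : F) else 0)
      (fun e he => if_neg he) K
    simpa only [SimpleGraph.mem_edgeSet] using this
  have hmain : ∀ K, ∑ v, (if J.connectedComponentMk v = K then
      (if v ∈ Cs then tr4 (g' s(v, l v) ^ 2 * s s(v, n1 v)) else 0) else 0) = tr4 (m K K) := by
    intro K
    have h1 : ∑ v, (if J.connectedComponentMk v = K then
      (if v ∈ Cs then tr4 (g' s(v, l v) ^ 2 * s s(v, n1 v)) else 0) else 0) =
        tr4 (x K ^ 2 * ∑ K', x K' * m K K') := by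
      simp only [m, Finset.mul_sum]
      rw [Finset.sum_comm, tr4_sum h4]
      apply Finset.sum_congr rfl
      intro v _
      by_cases hK : J.connectedComponentMk v = K
      · rw [if_pos hK]
        by_cases hv : v ∈ Cs
        · rw [if_pos hv, hg', hK, hgKin K v hv, if_pos hK]
          congr 1
          simp only [s, Finset.mul_sum]
          apply Finset.sum_congr rfl
          intro K' _
          ring
        · rw [if_neg hv, hgKout K v hv]
          simp [tr4]
      · rw [if_neg hK]
        have : gK K v = 0 := by
          simp [gK, hK]
        rw [this]
        simp [tr4]
    rw [h1]
    have h2 : ∑ K', x K' * m K K' = x K * m K K + (if d K then x K else 0) := by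
      have h3 := hker K
      have h5 : ∑ K', x K' * m K K' =
          ∑ K', (if K = K' then 0 else m K K') * x K' + x K * m K K := by
        rw [← Finset.add_sum_erase _ _ (Finset.mem_univ K),
          ← Finset.add_sum_erase (s := Finset.univ) (a := K)
            (f := fun K' => (if K = K' then 0 else m K K') * x K') (h := Finset.mem_univ K)]
        rw [if_pos rfl, zero_mul, zero_add, add_comm]
        congr 1
        apply Finset.sum_congr rfl
        intro K' hK'
        rw [if_neg (Finset.ne_of_mem_erase hK').symm, mul_comm]
      rw [h5]
      have h6 := f4_two h4 (if d K then x K else 0)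
      linear_combination h3 - h6
    rw [h2]
    have h3 := cube4 h4 (hx K)
    have h5 : x K ^ 2 * (x K * m K K + (if d K then x K else 0)) =
        m K K + (if d K then 1 else 0) := by
      split_ifs
      · linear_combination (m K K + 1) * h3
      · linear_combination (m K K) * h3
    rw [h5, tr4_add h4]
    have : tr4 (if d K then (1 : F) else 0) = 0 := by
      rw [tr4_eq_zero h4]
      split_ifs <;> simp
    rw [this, add_zero]
  have hτ0 : ∀ K, ∑ v, (if J.connectedComponentMk v = K then τ v else 0) = 0 := by
    intro K
    have h1 := hmain K
    rw [hself K] at h1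
    have h2 := hdeg K
    have h3 : ∑ v, (if J.connectedComponentMk v = K then τ v else 0) =
        ∑ v, (if J.connectedComponentMk v = K then
      (if v ∈ Cs then tr4 (g' s(v, l v) ^ 2 * s s(v, n1 v)) else 0) else 0) +
      (∑ v, (if J.connectedComponentMk v = K then
        ∑ w, (if J.Adj v w then (1 : F) else 0) else 0) +
      ∑ v, if J.connectedComponentMk v = K then (if v ∈ Cs then (1 : F) else 0) else 0) := by
      rw [← Finset.sum_add_distrib, ← Finset.sum_add_distrib]
      apply Finset.sum_congr rfl
      intro v _
      by_cases hK : J.connectedComponentMk v = K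
      · simp only [hK, if_true, τ]
        by_cases hv : v ∈ Cs
        · have h7 : ∑ w, (if J.Adj v w then (1 : F) else 0) = 1 := by
            simp only [hl v hv]
            simp
          rw [if_pos hv, if_pos hv, if_pos hv, h7, f4_two h4, add_zero]
        · simp only [if_neg hv, zero_add, add_zero]
      · simp [hK]
    rw [h3, h1, h2, zero_add, f4_two h4]
  obtain ⟨t0, ht0, ht⟩ := boundary_exists (f4_two h4) J τ hτ0
  obtain ⟨ω, hω⟩ := exists_omega h4
  have htb : ∀ v, ∑ w, tr4 (ω * t0 s(v, w)) = τ v := by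
    intro v
    rw [← tr4_sum h4, ← Finset.mul_sum, ht]
    rcases idem_cases (hτi v) with h | h
    · rw [h]
      simp [tr4]
    · rw [h, mul_one, hω]
  refine ⟨s, g', fun e => tr4 (ω * t0 e), ?_, ?_, ?_, ?_, hs, ?_, ?_⟩
  · intro e
    induction e with | _ v w
    rw [hg', ← hg]
    simp [hx]
  · intro v hv
    simp_rw [hg']
    rw [← Finset.mul_sum, hg0 v hv, mul_zero]
  · intro e he
    simp [ht0 e he, tr4]
  · intro e
    exact tr4_idem h4 _
  · intro v hv
    have h1 := htb v
    simp only [τ, if_pos hv] at h1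
    rw [← h1]
    symm
    apply Finset.sum_eq_single (l v)
    · intro w _ hw
      rw [ht0]
      · simp [tr4]
      · rw [SimpleGraph.mem_edgeSet, hl v hv]
        exact hw
    · simp
  · intro v hv
    have h1 := htb v
    simp only [τ, if_neg hv] at h1
    exact h1

/-- The main labelling theorem. -/
theorem labelling [Fintype V] (h4 : Fintype.card F = 4)
    (A J : SimpleGraph V) (Cs : Set V) (n1 n2 l : V → V)
    (hn : ∀ v ∈ Cs, n1 v ≠ n2 v) (hA : ∀ v ∈ Cs, ∀ w, A.Adj v w ↔ w = n1 v ∨ w = n2 v)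
    (hA0 : ∀ v ∉ Cs, ∀ w, ¬ A.Adj v w)
    (hAc : ∀ u ∈ Cs, ∀ v ∈ Cs, A.Reachable u v)
    (hl : ∀ v ∈ Cs, ∀ w, J.Adj v w ↔ w = l v)
    (hdis : ∀ v w, A.Adj v w → ¬ J.Adj v w)
    (g : Sym2 V → F) (hg : ∀ e, g e ≠ 0 ↔ e ∈ J.edgeSet)
    (hg0 : ∀ v ∉ Cs, ∑ w, g s(v, w) = 0) :
    ∃ S : F → Set (Sym2 V), (∀ z, S z ⊆ A.edgeSet ∪ J.edgeSet) ∧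
      (∀ e ∈ A.edgeSet, (Finset.univ.filter fun z => e ∈ S z).card = 1) ∧
      (∀ e ∈ J.edgeSet, (Finset.univ.filter fun z => e ∈ S z).card = 2) ∧
      ∀ z, EvenEdgeSet (S z) := by
  obtain ⟨s, g', t, hg', hg0', ht0, hti, hs, hleg, hR⟩ :=
    exists_twist h4 A J Cs n1 n2 l hn hA hA0 hAc hl g hg hg0
  have hdis' : ∀ e ∈ A.edgeSet, e ∉ J.edgeSet := by
    intro e
    induction e with | _ v w
    exact hdis v w
  refine ⟨fun z => {e | (e ∈ A.edgeSet ∧ s e = z) ∨ (e ∈ J.edgeSet ∧ tr4 (g' e ^ 2 * z) = t e)},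
    ?_, ?_, ?_, ?_⟩
  · intro z e he
    rcases he with h | h
    · exact Or.inl h.1
    · exact Or.inr h.1
  · intro e he
    rw [Finset.card_eq_one]
    refine ⟨s e, ?_⟩
    ext z
    simp [he, hdis' e he, eq_comm]
  · intro e he
    have h1 : e ∉ A.edgeSet := fun h => hdis' e h he
    have h2 := card_tr4 h4 ((hg' e).2 he) (hti e)
    refine Eq.trans ?_ h2
    congr 1
    ext z
    simp [he, h1]
  · intro z v
    apply even_of_cast h4
    have h1 : (({w : V | s(v, w) ∈ {e | (e ∈ A.edgeSet ∧ s e = z) ∨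
        (e ∈ J.edgeSet ∧ tr4 (g' e ^ 2 * z) = t e)}}.ncard : ℕ) : F) =
        ∑ w, (if A.Adj v w ∧ s s(v, w) = z then (1 : F) else 0) +
        ∑ w, (if J.Adj v w ∧ tr4 (g' s(v, w) ^ 2 * z) = t s(v, w) then (1 : F) else 0) := by
      rw [← Finset.sum_add_distrib, Set.ncard_eq_toFinset_card', ]
      have : ∀ w, ((if A.Adj v w ∧ s s(v, w) = z then (1 : F) else 0) +
          (if J.Adj v w ∧ tr4 (g' s(v, w) ^ 2 * z) = t s(v, w) then (1 : F) else 0)) =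
          if ((A.Adj v w ∧ s s(v, w) = z) ∨
            (J.Adj v w ∧ tr4 (g' s(v, w) ^ 2 * z) = t s(v, w))) then (1 : F) else 0 := by
        intro w
        by_cases h : A.Adj v w
        · have := hdis v w h
          simp [h, this]
        · simp [h]
      simp_rw [this]
      rw [Finset.sum_boole]
      congr 2
      ext w
      simp
    rw [h1]
    by_cases hv : v ∈ Cs
    · have h2 : ∑ w, (if A.Adj v w ∧ s s(v, w) = z then (1 : F) else 0) =
          (if s s(v, n1 v) = z then (1 : F) else 0) +
          (if s s(v, n1 v) + g' s(v, l v) = z then (1 : F) else 0) := by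
        rw [Finset.sum_eq_add (n1 v) (n2 v) (hn v hv)]
        · have h3 : s s(v, n2 v) = s s(v, n1 v) + g' s(v, l v) := by
            have h5 := hs v hv
            have h6 := f4_two h4 (s s(v, n1 v))
            linear_combination h5 - h6
          rw [← h3]
          simp [hA v hv]
        · intro w _ hw
          rw [if_neg]
          rw [hA v hv]
          tauto
        · simp
        · simp
      have h3 : ∑ w, (if J.Adj v w ∧ tr4 (g' s(v, w) ^ 2 * z) = t s(v, w) then (1 : F) else 0) =
          (if tr4 (g' s(v, l v) ^ 2 * z) = tr4 (g' s(v, l v) ^ 2 * s s(v, n1 v))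
            then (1 : F) else 0) := by
        rw [Finset.sum_eq_single (l v), ← hleg v hv]
        · simp [hl v hv]
        · intro w _ hw
          rw [if_neg]
          rw [hl v hv]
          tauto
        · simp
      rw [h2, h3]
      apply local_even h4
      rw [hg', SimpleGraph.mem_edgeSet, hl v hv]
    · have h2 : ∑ w, (if A.Adj v w ∧ s s(v, w) = z then (1 : F) else 0) = 0 := by
        apply Finset.sum_eq_zero
        intro w _
        rw [if_neg]
        intro h
        exact hA0 v hv w h.1
      rw [h2, zero_add]
      have h3 : ∀ w, (if J.Adj v w ∧ tr4 (g' s(v, w) ^ 2 * z) = t s(v, w) then (1 : F) else 0) =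
          (if J.Adj v w then 1 else 0) + tr4 (g' s(v, w) ^ 2 * z) + t s(v, w) := by
        intro w
        by_cases h : J.Adj v w
        · simp only [h, true_and, if_true]
          exact idem_ind h4 (tr4_idem h4 _) (hti _)
        · have h5 : g' s(v, w) = 0 := by
            by_contra h6
            exact h ((hg' _).1 h6)
          rw [ht0 _ h, h5]
          simp [h, tr4]
      simp_rw [h3]
      rw [Finset.sum_add_distrib, Finset.sum_add_distrib, hR v hv, ← tr4_sum h4,
        ← Finset.sum_mul, ← sq_sum4 h4, hg0' v hv]
      have := f4_two h4 (∑ w, if J.Adj v w then (1 : F) else 0)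
      simp only [tr4]
      linear_combination this
end

/-- The component of an edge set, as a subgraph. -/
def compSub (G : SimpleGraph V) (S : Set (Sym2 V)) (hS : S ⊆ G.edgeSet)
    (K : (SimpleGraph.fromEdgeSet S).ConnectedComponent) : G.Subgraph where
  verts := {v | (SimpleGraph.fromEdgeSet S).connectedComponentMk v = K}
  Adj v w := s(v, w) ∈ S ∧ (SimpleGraph.fromEdgeSet S).connectedComponentMk v = K
  adj_sub h := hS h.1
  edge_vert h := h.2
  symm := ⟨by
    rintro v w ⟨h1, h2⟩
    refine ⟨by rwa [Sym2.eq_swap], ?_⟩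
    rw [← h2]
    apply SimpleGraph.ConnectedComponent.sound
    apply SimpleGraph.Adj.reachable
    rw [SimpleGraph.fromEdgeSet_adj]
    refine ⟨by rwa [Sym2.eq_swap], ?_⟩
    exact (G.ne_of_adj (hS h1)).symm⟩

theorem cycles_of_even [Fintype V] (G : SimpleGraph V) (hG : IsCubic G) (S : Set (Sym2 V))
    (hS : S ⊆ G.edgeSet) (he : EvenEdgeSet S) :
    ∃ D : Multiset G.Subgraph, (∀ C ∈ D, IsCycleSub C) ∧
      ∀ e, D.countP (fun C => e ∈ C.edgeSet) = if e ∈ S then 1 else 0 := by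
  set B := SimpleGraph.fromEdgeSet S with hB
  have hBadj : ∀ v w, B.Adj v w ↔ s(v, w) ∈ S := by
    intro v w
    rw [hB, SimpleGraph.fromEdgeSet_adj]
    constructor
    · exact fun h => h.1
    · exact fun h => ⟨h, G.ne_of_adj (hS h)⟩
  let P : B.ConnectedComponent → Prop := fun K => ∃ v w, B.connectedComponentMk v = K ∧ s(v, w) ∈ S
  have hcount : ∀ e (K : B.ConnectedComponent), e ∈ (compSub G S hS K).edgeSet →
      P K := by
    intro e K h
    induction e with | _ v w
    rw [SimpleGraph.Subgraph.mem_edgeSet] at h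
    exact ⟨v, w, h.2, h.1⟩
  refine ⟨(Finset.univ.filter P).val.map (compSub G S hS), ?_, ?_⟩
  · intro C hC
    rw [Multiset.mem_map] at hC
    obtain ⟨K, hK, rfl⟩ := hC
    rw [Finset.mem_val, Finset.mem_filter] at hK
    obtain ⟨v0, w0, hv0, hvw0⟩ := hK.2
    have hreach : ∀ {u v : V} (p : B.Walk u v) (hu : u ∈ (compSub G S hS K).verts)
        (hv : v ∈ (compSub G S hS K).verts),
        (compSub G S hS K).coe.Reachable ⟨u, hu⟩ ⟨v, hv⟩ := by
      intro u v p
      induction p with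
      | nil =>
        intro hu hv
        exact SimpleGraph.Reachable.refl _
      | @cons u v w h p ih =>
        intro hu hw
        have hadj : (compSub G S hS K).Adj u v := ⟨(hBadj u v).1 h, hu⟩
        have hv : v ∈ (compSub G S hS K).verts := hadj.snd_mem
        refine SimpleGraph.Reachable.trans ?_ (ih hv hw)
        exact SimpleGraph.Adj.reachable hadj.coe
    refine ⟨?_, ?_⟩
    · rw [SimpleGraph.Subgraph.connected_iff]
      refine ⟨⟨?_⟩, ⟨v0, hv0⟩⟩
      rintro ⟨u, hu⟩ ⟨v, hv⟩
      obtain ⟨p⟩ := SimpleGraph.ConnectedComponent.exact (hu.trans hv.symm)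
      exact hreach p hu hv
    · intro v hv
      have hv' : B.connectedComponentMk v = K := hv
      have h1 : (compSub G S hS K).neighborSet v = {w | s(v, w) ∈ S} := by
        ext w
        rw [SimpleGraph.Subgraph.mem_neighborSet]
        exact ⟨fun h => h.1, fun h => ⟨h, hv⟩⟩
      rw [h1]
      have h2 := he v
      have h3 : {w | s(v, w) ∈ S}.ncard ≤ 3 := by
        rw [← hG v]
        apply Set.ncard_le_ncard _ (Set.toFinite _)
        intro w hw
        exact hS hw
      have h4 : {w | s(v, w) ∈ S}.ncard ≠ 0 := by
        suffices hne : {w | s(v, w) ∈ S}.Nonempty by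
          exact ((Set.ncard_pos (Set.toFinite _)).2 hne).ne'
        by_cases hvv : v = v0
        · exact ⟨w0, by rw [hvv]; exact hvw0⟩
        · obtain ⟨p⟩ := SimpleGraph.ConnectedComponent.exact (hv'.trans hv0.symm)
          cases p with
          | nil => exact absurd rfl hvv
          | cons h p => exact ⟨_, (hBadj _ _).1 h⟩
      obtain ⟨k, hk⟩ := h2
      omega
  · intro e
    rw [Multiset.countP_map]
    by_cases heS : e ∈ S
    · rw [if_pos heS]
      induction e with | _ v w
      have : Multiset.filter (fun K => s(v, w) ∈ (compSub G S hS K).edgeSet)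
          (Finset.univ.filter P).val = {B.connectedComponentMk v} := by
        rw [← Finset.filter_val, ← Finset.singleton_val, Finset.val_inj]
        ext K
        simp only [Finset.mem_filter, Finset.mem_univ, true_and, Finset.mem_singleton]
        constructor
        · rintro ⟨_, h⟩
          rw [SimpleGraph.Subgraph.mem_edgeSet] at h
          exact h.2.symm
        · rintro rfl
          have : s(v, w) ∈ (compSub G S hS (B.connectedComponentMk v)).edgeSet := by
            rw [SimpleGraph.Subgraph.mem_edgeSet]
            exact ⟨heS, rfl⟩
          exact ⟨hcount _ _ this, this⟩
      rw [this]
      rfl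
    · rw [if_neg heS, Multiset.card_eq_zero, Multiset.filter_eq_nil]
      intro K _ h
      apply heS
      induction e with | _ v w
      rw [SimpleGraph.Subgraph.mem_edgeSet] at h
      exact h.1

theorem cdc_of_even_sets [Fintype V] (G : SimpleGraph V) (hG : IsCubic G) {ι : Type*} [Fintype ι]
    (T : ι → Set (Sym2 V)) (hsub : ∀ i, T i ⊆ G.edgeSet) (heven : ∀ i, EvenEdgeSet (T i))
    (hcount : ∀ e ∈ G.edgeSet, (Finset.univ.filter fun i => e ∈ T i).card = 2) :
    ∃ D : Multiset G.Subgraph, IsCDC G D := by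
  choose D hD hc using fun i => cycles_of_even G hG (T i) (hsub i) (heven i)
  refine ⟨∑ i, D i, ?_, ?_⟩
  · intro C hC
    rw [Multiset.mem_sum] at hC
    obtain ⟨i, _, hi⟩ := hC
    exact hD i C hi
  · intro e he
    have h1 := map_sum (Multiset.countPAddMonoidHom (fun C : G.Subgraph => e ∈ C.edgeSet)) D
      Finset.univ
    simp only [Multiset.coe_countPAddMonoidHom] at h1
    rw [h1]
    simp_rw [hc]
    rw [← hcount e he, Finset.card_filter]

theorem local_extend {F : Type*} [Field F] [Fintype F] (h4 : Fintype.card F = 4) [Fintype V]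
    (N : Set V) (hN : N.ncard = 3) (P : Set V) (c : V → F)
    (hc : ∀ w ∈ N, w ∈ P → c w ≠ 0)
    (hinj : ∀ w ∈ N, ∀ w' ∈ N, w ∈ P → w' ∈ P → c w = c w' → w = w') :
    ∃ φ : V → F, (∀ w ∈ N, φ w ≠ 0) ∧ (∀ w ∈ N, w ∈ P → φ w = c w) ∧
      ∑ w, (if w ∈ N then φ w else 0) = 0 := by
  have hcard : Fintype.card N = (Finset.univ.erase (0 : F)).card := by
    rw [Finset.card_erase_of_mem (Finset.mem_univ _), Finset.card_univ, h4,
      ← Nat.card_eq_fintype_card, Nat.card_coe_set_eq, hN]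
  obtain ⟨e, he⟩ := Finset.exists_equiv_extend_of_card_eq (α := N) hcard
    (s := Finset.univ.filter fun w => (w : V) ∈ P) (f := fun w => c w) (by
      intro y hy
      simp only [Finset.mem_image, Finset.mem_filter, Finset.mem_univ, true_and] at hy
      obtain ⟨a, ha, rfl⟩ := hy
      simp [hc a a.2 ha]) (by
      intro a ha b hb hab
      simp only [Finset.coe_filter, Finset.mem_univ, true_and] at ha hb
      exact Subtype.ext (hinj a a.2 b b.2 ha hb hab))
  refine ⟨fun w => if h : w ∈ N then (e ⟨w, h⟩ : F) else 0, ?_, ?_, ?_⟩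
  · intro w hw
    simp only [hw, dif_pos]
    exact Finset.ne_of_mem_erase (e ⟨w, hw⟩).2
  · intro w hw hP
    simp only [hw, dif_pos]
    exact he ⟨w, hw⟩ (by simpa using hP)
  · have h1 : ∑ w, (if w ∈ N then (if h : w ∈ N then (e ⟨w, h⟩ : F) else 0) else 0) =
        ∑ a : N, (e a : F) := by
      rw [← Finset.sum_filter]
      rw [← Finset.sum_subtype_of_mem (p := fun w => w ∈ N)]
      · apply Finset.sum_bij (fun a _ => a)
        · simp
        · intro a _ b _ h
          exact h
        · intro b _
          exact ⟨b, by simp, rfl⟩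
        · intro a _
          simp [a.2]
      · simp
    rw [h1, Equiv.sum_comp e (fun y => (y : F)), Finset.sum_coe_sort _ (fun y => y)]
    have h2 := FiniteField.sum_pow_lt_card_sub_one F 1 (by rw [h4]; norm_num)
    simp only [pow_one] at h2
    have h3 := Finset.add_sum_erase Finset.univ (fun y : F => y) (Finset.mem_univ (0 : F))
    rw [h2, zero_add] at h3
    exact h3

theorem flow_extend {F : Type*} [Field F] [Fintype F] (h4 : Fintype.card F = 4) [Fintype V]
    (J : SimpleGraph V) (Q : Set V) (hQ : ∀ r ∈ Q, (J.neighborSet r).ncard = 3)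
    (P : Set (Sym2 V)) (c : Sym2 V → F) (hc : ∀ e ∈ P, c e ≠ 0)
    (hQP : ∀ v w, J.Adj v w → v ∈ Q → w ∈ Q → s(v, w) ∈ P)
    (hinj : ∀ r ∈ Q, ∀ w w', J.Adj r w → J.Adj r w' → s(r, w) ∈ P → s(r, w') ∈ P →
      c s(r, w) = c s(r, w') → w = w') :
    ∃ g : Sym2 V → F, (∀ e, g e ≠ 0 ↔ e ∈ J.edgeSet) ∧ (∀ e ∈ P, e ∈ J.edgeSet → g e = c e) ∧
      ∀ r ∈ Q, ∑ w, g s(r, w) = 0 := by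
  have hφ : ∀ r : V, ∃ φ : V → F, r ∈ Q → ((∀ w, J.Adj r w → φ w ≠ 0) ∧
      (∀ w, J.Adj r w → s(r, w) ∈ P → φ w = c s(r, w)) ∧
      ∑ w, (if J.Adj r w then φ w else 0) = 0) := by
    intro r
    by_cases hr : r ∈ Q
    · obtain ⟨φ, h1, h2, h3⟩ := local_extend h4 (J.neighborSet r) (hQ r hr)
        {w | s(r, w) ∈ P} (fun w => c s(r, w)) (fun w _ hw => hc _ hw)
        (fun w hw w' hw' hP hP' h => hinj r hr w w' hw hw' hP hP' h)
      exact ⟨φ, fun _ => ⟨h1, h2, h3⟩⟩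
    · exact ⟨fun _ => 0, fun h => absurd h hr⟩
  choose φ hφ using hφ
  let f : V → V → F := fun v w => if J.Adj v w then (if s(v, w) ∈ P then c s(v, w) else
    if v ∈ Q then φ v w else if w ∈ Q then φ w v else 1) else 0
  have hf : ∀ v w, f v w = f w v := by
    intro v w
    by_cases h : J.Adj v w
    · by_cases hP : s(v, w) ∈ P
      · simp only [f, h, h.symm, Sym2.eq_swap (a := w) (b := v), hP, if_true]
      · have : ¬ (v ∈ Q ∧ w ∈ Q) := fun h1 => hP (hQP v w h h1.1 h1.2)
        simp only [f, h, h.symm, Sym2.eq_swap (a := w) (b := v), hP, if_true, if_false]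
        by_cases hv : v ∈ Q
        · have hw : w ∉ Q := fun hw => this ⟨hv, hw⟩
          simp [hv, hw]
        · simp [hv]
    · have h' : ¬ J.Adj w v := fun h1 => h h1.symm
      simp only [f, h, h', if_false]
  refine ⟨Sym2.lift ⟨f, hf⟩, ?_, ?_, ?_⟩
  · intro e
    induction e with | _ v w
    rw [Sym2.lift_mk]
    simp only [SimpleGraph.mem_edgeSet, f]
    by_cases h : J.Adj v w
    · simp only [h, if_true, iff_true]
      by_cases hP : s(v, w) ∈ P
      · rw [if_pos hP]
        exact hc _ hP
      · rw [if_neg hP]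
        by_cases hv : v ∈ Q
        · rw [if_pos hv]
          exact (hφ v hv).1 w h
        · rw [if_neg hv]
          by_cases hw : w ∈ Q
          · rw [if_pos hw]
            exact (hφ w hw).1 v h.symm
          · rw [if_neg hw]
            exact one_ne_zero
    · simp [h]
  · intro e he hJ
    induction e with | _ v w
    rw [Sym2.lift_mk]
    rw [SimpleGraph.mem_edgeSet] at hJ
    simp [f, hJ, he]
  · intro r hr
    rw [← (hφ r hr).2.2]
    apply Finset.sum_congr rfl
    intro w _
    rw [Sym2.lift_mk]
    simp only [f]
    by_cases h : J.Adj r w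
    · simp only [h, hr, if_true]
      split_ifs with hP
      · exact ((hφ r hr).2.1 w h hP).symm
      · rfl
    · simp [h]

theorem cycle_setup [Fintype V] {G : SimpleGraph V} (hG : IsCubic G) {C : G.Subgraph}
    (hC : IsCycleSub C) : ∃ n1 n2 l : V → V, ∀ v ∈ C.verts, n1 v ≠ n2 v ∧
      (∀ w, C.Adj v w ↔ w = n1 v ∨ w = n2 v) ∧
      (∀ w, (G.Adj v w ∧ ¬ C.Adj v w) ↔ w = l v) := by
  have : ∀ v : V, ∃ a b d : V, v ∈ C.verts → (a ≠ b ∧ (∀ w, C.Adj v w ↔ w = a ∨ w = b) ∧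
      (∀ w, (G.Adj v w ∧ ¬ C.Adj v w) ↔ w = d)) := by
    intro v
    by_cases hv : v ∈ C.verts
    · have h1 := hC.2 v hv
      obtain ⟨a, b, hab, h2⟩ := Set.ncard_eq_two.1 h1
      have h3 : (G.neighborSet v \ C.neighborSet v).ncard = 1 := by
        rw [Set.ncard_sdiff (C.neighborSet_subset v) (Set.toFinite _), hG v, h1]
      obtain ⟨d, hd⟩ := Set.ncard_eq_one.1 h3
      refine ⟨a, b, d, fun _ => ⟨hab, ?_, ?_⟩⟩
      · intro w
        have := Set.ext_iff.1 h2 w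
        simpa using this
      · intro w
        have := Set.ext_iff.1 hd w
        simpa using this
    · exact ⟨v, v, v, fun h => absurd h hv⟩
  choose a b d h using this
  exact ⟨a, b, d, h⟩

theorem cycle_reach {G : SimpleGraph V} {C : G.Subgraph} (hC : IsCycleSub C) :
    ∀ u ∈ C.verts, ∀ v ∈ C.verts, C.spanningCoe.Reachable u v := by
  intro u hu v hv
  have h1 := hC.1
  rw [SimpleGraph.Subgraph.connected_iff] at h1
  have h2 := h1.1.coe ⟨u, hu⟩ ⟨v, hv⟩
  have h3 := h2.map (f := (⟨fun x => x.1, fun h => h⟩ : C.coe →g C.spanningCoe))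
  exact h3

theorem cdc_of_even_sets_option [Fintype V] (G : SimpleGraph V) (hG : IsCubic G)
    {F : Type*} [Fintype F] (T0 : Set (Sym2 V)) (T : F → Set (Sym2 V))
    (hsub0 : T0 ⊆ G.edgeSet) (heven0 : EvenEdgeSet T0)
    (hsub : ∀ i, T i ⊆ G.edgeSet) (heven : ∀ i, EvenEdgeSet (T i))
    (hcount0 : ∀ e ∈ G.edgeSet, e ∈ T0 → (Finset.univ.filter fun i => e ∈ T i).card = 1)
    (hcount : ∀ e ∈ G.edgeSet, e ∉ T0 → (Finset.univ.filter fun i => e ∈ T i).card = 2) :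
    ∃ D : Multiset G.Subgraph, IsCDC G D := by
  refine cdc_of_even_sets G hG (ι := Option F) (fun o => o.elim T0 T) ?_ ?_ ?_
  · rintro (_ | z)
    · exact hsub0
    · exact hsub z
  · rintro (_ | z)
    · exact heven0
    · exact heven z
  · intro e he
    rw [Finset.card_filter, Fintype.sum_option]
    by_cases h : e ∈ T0
    · have h1 := hcount0 e he h
      rw [Finset.card_filter] at h1
      have h2 : e ∈ (none : Option F).elim T0 T := h
      rw [if_pos h2]
      exact congrArg (fun x => 1 + x) h1
    · have h1 := hcount e he h
      rw [Finset.card_filter] at h1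
      have h2 : e ∉ (none : Option F).elim T0 T := h
      rw [if_neg h2, zero_add]
      exact h1

theorem even_cycle_set {G : SimpleGraph V} {C : G.Subgraph} (hC : IsCycleSub C) :
    EvenEdgeSet C.edgeSet := by
  intro v
  by_cases hv : v ∈ C.verts
  · have := hC.2 v hv
    have h1 : {w | s(v, w) ∈ C.edgeSet} = C.neighborSet v := by
      ext w
      simp
    rw [h1, this]
    exact even_two
  · have h1 : {w | s(v, w) ∈ C.edgeSet} = ∅ := by
      ext w
      simp only [SimpleGraph.Subgraph.mem_edgeSet]
      constructor
      · intro h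
        exact absurd (C.edge_vert h) hv
      · simp
    rw [h1]
    simp

/-- The case in which the vertices off the cycle induce a colourable graph. -/
theorem cdc_colourable {F : Type*} [Field F] [Fintype F] (h4 : Fintype.card F = 4) [Fintype V]
    (G : SimpleGraph V) (hG : IsCubic G) (C : G.Subgraph) (hC : IsCycleSub C)
    (c : Sym2 V → F) (hc : ∀ e, c e ≠ 0)
    (hinj : ∀ v w w', v ∉ C.verts → w ∉ C.verts → w' ∉ C.verts → G.Adj v w → G.Adj v w' →
      c s(v, w) = c s(v, w') → w = w') :
    ∃ D : Multiset G.Subgraph, IsCDC G D := by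
  obtain ⟨n1, n2, l, hset⟩ := cycle_setup hG hC
  let J : SimpleGraph V := G \ C.spanningCoe
  have hJ : ∀ v w, J.Adj v w ↔ G.Adj v w ∧ ¬ C.Adj v w := by
    intro v w
    simp [J]
  have hJo : ∀ v ∉ C.verts, ∀ w, J.Adj v w ↔ G.Adj v w := by
    intro v hv w
    rw [hJ]
    constructor
    · exact fun h => h.1
    · exact fun h => ⟨h, fun h1 => hv (C.edge_vert h1)⟩
  obtain ⟨g, hg, _, hg0⟩ := flow_extend h4 J C.vertsᶜ (by
      intro r hr
      rw [← hG r]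
      congr 1
      ext w
      exact hJo r hr w)
    {e | ∀ v ∈ e, v ∉ C.verts} c (fun e _ => hc e) (by
      intro v w _ hv hw u hu
      rw [Sym2.mem_iff] at hu
      rcases hu with rfl | rfl
      · exact hv
      · exact hw) (by
      intro r hr w w' hw hw' hP hP' h
      exact hinj r w w' hr (hP w (by simp)) (hP' w' (by simp)) ((hJ _ _).1 hw).1
        ((hJ _ _).1 hw').1 h)
  obtain ⟨S, hS, hS1, hS2, hSe⟩ := labelling h4 C.spanningCoe J C.verts n1 n2 l
    (fun v hv => (hset v hv).1) (fun v hv w => (hset v hv).2.1 w)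
    (fun v hv w h => hv (C.edge_vert h)) (cycle_reach hC)
    (fun v hv w => by rw [hJ]; exact (hset v hv).2.2 w)
    (fun v w h h1 => ((hJ v w).1 h1).2 h) g hg hg0
  refine cdc_of_even_sets_option G hG C.edgeSet S C.edgeSet_subset (even_cycle_set hC) ?_ hSe
    (fun e _ h => hS1 e h) ?_
  · intro z e he
    rcases hS z he with h | h
    · exact C.edgeSet_subset h
    · induction e with | _ v w
      exact ((hJ v w).1 h).1
  · intro e he h
    apply hS2
    induction e with | _ v w
    exact (hJ v w).2 ⟨he, h⟩

/-- Proper edge colouring with three colours. -/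
def Prop3 (H : SimpleGraph V) (c : Sym2 V → Fin 3) : Prop :=
  ∀ v w w', H.Adj v w → H.Adj v w' → c s(v, w) = c s(v, w') → w = w'

def Miss (H : SimpleGraph V) (c : Sym2 V → Fin 3) (v : V) (a : Fin 3) : Prop :=
  ∀ w, H.Adj v w → c s(v, w) ≠ a

/-- The graph of a Kempe pair. -/
def kempe (H : SimpleGraph V) (c : Sym2 V → Fin 3) (a b : Fin 3) : SimpleGraph V where
  Adj v w := H.Adj v w ∧ (c s(v, w) = a ∨ c s(v, w) = b)
  symm := ⟨by
    rintro v w ⟨h1, h2⟩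
    exact ⟨h1.symm, by rwa [Sym2.eq_swap]⟩⟩
  loopless := ⟨fun v h => H.loopless.irrefl v h.1⟩

theorem col_extend {H : SimpleGraph V} {x y : V} (hxy : H.Adj x y) {c : Sym2 V → Fin 3}
    (hc : Prop3 (H.deleteEdges {s(x, y)}) c) {a : Fin 3}
    (hx : Miss (H.deleteEdges {s(x, y)}) c x a) (hy : Miss (H.deleteEdges {s(x, y)}) c y a) :
    Prop3 H (fun e => if e = s(x, y) then a else c e) := by
  have key : ∀ v w, s(v, w) = s(x, y) → Miss (H.deleteEdges {s(x, y)}) c v a := by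
    intro v w h
    rw [Sym2.eq_iff] at h
    rcases h with h | h
    · rw [h.1]
      exact hx
    · rw [h.1]
      exact hy
  intro v w w' h1 h2 h3
  simp only at h3
  by_cases e1 : s(v, w) = s(x, y)
  · by_cases e2 : s(v, w') = s(x, y)
    · rw [← e2] at e1
      exact Sym2.congr_right.1 e1
    · rw [if_pos e1, if_neg e2] at h3
      have := key v w e1 w' (by
        rw [SimpleGraph.deleteEdges_adj]
        exact ⟨h2, e2⟩)
      exact absurd h3.symm this
  · by_cases e2 : s(v, w') = s(x, y)
    · rw [if_neg e1, if_pos e2] at h3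
      have := key v w' e2 w (by
        rw [SimpleGraph.deleteEdges_adj]
        exact ⟨h1, e1⟩)
      exact absurd h3 this
    · rw [if_neg e1, if_neg e2] at h3
      refine hc v w w' ?_ ?_ h3
      · rw [SimpleGraph.deleteEdges_adj]
        exact ⟨h1, e1⟩
      · rw [SimpleGraph.deleteEdges_adj]
        exact ⟨h2, e2⟩

theorem kempe_swap {H : SimpleGraph V} {c : Sym2 V → Fin 3} (hc : Prop3 H c) (a b : Fin 3)
    (U : Set V) (hU : ∀ v w, (kempe H c a b).Adj v w → v ∈ U → w ∈ U) :
    ∃ c' : Sym2 V → Fin 3, Prop3 H c' ∧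
      (∀ v w, H.Adj v w → v ∈ U → c' s(v, w) = Equiv.swap a b (c s(v, w))) ∧
      (∀ v w, H.Adj v w → v ∉ U → c' s(v, w) = c s(v, w)) := by
  let c' : Sym2 V → Fin 3 := fun e => if ∃ v ∈ e, v ∈ U then Equiv.swap a b (c e) else c e
  have h1 : ∀ v w, H.Adj v w → v ∈ U → c' s(v, w) = Equiv.swap a b (c s(v, w)) := by
    intro v w _ hv
    have : ∃ u ∈ s(v, w), u ∈ U := ⟨v, by simp, hv⟩
    simp only [c']
    rw [if_pos this]
  have h2 : ∀ v w, H.Adj v w → v ∉ U → c' s(v, w) = c s(v, w) := by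
    intro v w h hv
    simp only [c']
    by_cases hw : w ∈ U
    · have h3 : ¬ (c s(v, w) = a ∨ c s(v, w) = b) := by
        intro h4
        apply hv
        refine hU w v ⟨h.symm, ?_⟩ hw
        rwa [Sym2.eq_swap]
      push Not at h3
      rw [Equiv.swap_apply_of_ne_of_ne h3.1 h3.2, ite_self]
    · rw [if_neg]
      rintro ⟨u, hu, hu'⟩
      rw [Sym2.mem_iff] at hu
      rcases hu with rfl | rfl
      · exact hv hu'
      · exact hw hu'
  refine ⟨c', ?_, h1, h2⟩
  intro v w w' hw hw' h
  by_cases hv : v ∈ U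
  · rw [h1 v w hw hv, h1 v w' hw' hv] at h
    exact hc v w w' hw hw' ((Equiv.swap a b).injective h)
  · rw [h2 v w hw hv, h2 v w' hw' hv] at h
    exact hc v w w' hw hw' h

theorem kempe_reach {H : SimpleGraph V} (hH : ¬ ∃ c, Prop3 H c) {x y : V} (hxy : H.Adj x y)
    {c : Sym2 V → Fin 3} (hc : Prop3 (H.deleteEdges {s(x, y)}) c) {a b : Fin 3}
    (hx : Miss (H.deleteEdges {s(x, y)}) c x a) (hy : Miss (H.deleteEdges {s(x, y)}) c y b) :
    (kempe (H.deleteEdges {s(x, y)}) c a b).Reachable y x := by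
  by_contra hcon
  obtain ⟨c', hc', h1, h2⟩ := kempe_swap hc a b
    {v | (kempe (H.deleteEdges {s(x, y)}) c a b).Reachable y v}
    (fun v w h hv => SimpleGraph.Reachable.trans hv h.reachable)
  apply hH
  refine ⟨_, col_extend hxy hc' (a := a) ?_ ?_⟩
  · intro w hw
    rw [h2 x w hw hcon]
    exact hx w hw
  · intro w hw h
    rw [h1 y w hw (SimpleGraph.Reachable.refl y)] at h
    apply hy w hw
    apply (Equiv.swap a b).injective
    rw [h, Equiv.swap_apply_right]

theorem no_three_ends [Fintype V] (B : SimpleGraph V) (h2 : ∀ v, B.degree v ≤ 2)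
    {x y w : V} (hxy : x ≠ y) (hxw : x ≠ w) (hyw : y ≠ w) (hx : B.degree x ≤ 1)
    (hy : B.degree y ≤ 1) (hw : B.degree w ≤ 1) (h1 : B.Reachable y x) (h3 : B.Reachable y w) :
    False := by
  set K := B.connectedComponentMk y
  have hyK : y ∈ K.supp := rfl
  have hxK : x ∈ K.supp := SimpleGraph.ConnectedComponent.sound h1.symm
  have hwK : w ∈ K.supp := SimpleGraph.ConnectedComponent.sound h3.symm
  have hcon : (B.induce K.supp).Connected := K.connected_toSimpleGraph
  have hle := hcon.card_vert_le_card_edgeSet_add_one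
  have hsum := (B.induce K.supp).sum_degrees_eq_twice_card_edges
  have hd : ∀ v : K.supp, (B.induce K.supp).degree v = B.degree v := by
    intro v
    have := SimpleGraph.degree_induce_of_neighborSet_subset (G := B) (s := K.supp) (v := v) (by
      intro u hu
      have hv := v.2
      rw [SimpleGraph.ConnectedComponent.mem_supp_iff] at hv ⊢
      rw [← hv]
      exact SimpleGraph.ConnectedComponent.sound (SimpleGraph.Adj.reachable hu).symm)
    convert this
  have hcard : (B.induce K.supp).edgeFinset.card = Nat.card (B.induce K.supp).edgeSet := by
    rw [Nat.card_eq_fintype_card, SimpleGraph.edgeFinset_card]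
  rw [← hcard, Nat.card_eq_fintype_card] at hle
  have hbound : ∑ v : K.supp, ((B.induce K.supp).degree v +
      ((if v = ⟨x, hxK⟩ then 1 else 0) + (if v = ⟨y, hyK⟩ then 1 else 0) +
        (if v = ⟨w, hwK⟩ then 1 else 0))) ≤ ∑ v : K.supp, 2 := by
    apply Finset.sum_le_sum
    intro v _
    rw [hd]
    by_cases e1 : v = ⟨x, hxK⟩
    · subst e1
      simp [hxy, hxw]
      exact hx
    · by_cases e2 : v = ⟨y, hyK⟩
      · subst e2
        simp [Ne.symm hxy, hyw]
        exact hy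
      · by_cases e3 : v = ⟨w, hwK⟩
        · subst e3
          simp [Ne.symm hxw, Ne.symm hyw]
          exact hw
        · simp [e1, e2, e3]
          exact h2 v
  rw [Finset.sum_add_distrib, Finset.sum_add_distrib, Finset.sum_add_distrib, hsum] at hbound
  simp only [Finset.sum_ite_eq', Finset.mem_univ, if_true, Finset.sum_const, Finset.card_univ,
    smul_eq_mul] at hbound
  omega

theorem kempe_degree [Fintype V] {H : SimpleGraph V} {c : Sym2 V → Fin 3} (hc : Prop3 H c)
    (a b : Fin 3) (v : V) : (kempe H c a b).degree v ≤ 2 := by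
  rw [← SimpleGraph.card_neighborFinset_eq_degree]
  refine (Finset.card_le_card_of_injOn (t := {a, b}) (fun w => c s(v, w)) ?_ ?_).trans
    Finset.card_le_two
  · intro w hw
    simp only [Finset.mem_coe, SimpleGraph.mem_neighborFinset] at hw
    simpa using hw.2
  · intro w hw w' hw' h
    simp only [Finset.mem_coe, SimpleGraph.mem_neighborFinset] at hw hw'
    exact hc v w w' hw.1 hw'.1 h

theorem kempe_degree_one [Fintype V] {H : SimpleGraph V} {c : Sym2 V → Fin 3} (hc : Prop3 H c)
    (a b : Fin 3) (v : V) (hm : Miss H c v a ∨ Miss H c v b) :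
    (kempe H c a b).degree v ≤ 1 := by
  rw [← SimpleGraph.card_neighborFinset_eq_degree, Finset.card_le_one]
  intro w hw w' hw'
  rw [SimpleGraph.mem_neighborFinset] at hw hw'
  apply hc v w w' hw.1 hw'.1
  rcases hm with hm | hm
  · rw [hw.2.resolve_left (hm w hw.1), hw'.2.resolve_left (hm w' hw'.1)]
  · rw [hw.2.resolve_right (hm w hw.1), hw'.2.resolve_right (hm w' hw'.1)]

theorem reach_closed {B : SimpleGraph V} (U : Set V) (hU : ∀ v w, B.Adj v w → v ∈ U → w ∈ U)
    {x y : V} (h : B.Reachable x y) (hx : x ∈ U) : y ∈ U := by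
  obtain ⟨p⟩ := h
  induction p with
  | nil => exact hx
  | cons h p ih => exact ih (hU _ _ h hx)

theorem exists_third (a b : Fin 3) : ∃ c, c ≠ a ∧ c ≠ b := by
  revert a b
  decide

theorem fin3_cases {a b c d : Fin 3} (h1 : a ≠ b) (h2 : c ≠ a) (h3 : c ≠ b) :
    d = a ∨ d = b ∨ d = c := by
  revert a b c d
  decide

theorem crit_degree [Fintype V] {H : SimpleGraph V} (hH : ¬ ∃ c, Prop3 H c)
    (hcrit : ∀ x y, H.Adj x y → ∃ c, Prop3 (H.deleteEdges {s(x, y)}) c)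
    {x y : V} (hxy : H.Adj x y) : 5 ≤ H.degree x + H.degree y := by
  obtain ⟨c, hc⟩ := hcrit x y hxy
  have hun : (Finset.univ : Finset (Fin 3)) ⊆
      (((H.neighborFinset x).erase y).image fun w => c s(x, w)) ∪
      (((H.neighborFinset y).erase x).image fun w => c s(y, w)) := by
    intro a _
    by_contra hcon
    simp only [Finset.mem_union, Finset.mem_image, Finset.mem_erase,
      SimpleGraph.mem_neighborFinset, not_or, not_exists] at hcon
    apply hH
    refine ⟨_, col_extend hxy hc (a := a) ?_ ?_⟩
    · intro w hw
      rw [SimpleGraph.deleteEdges_adj] at hw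
      refine fun h => hcon.1 w ⟨⟨?_, hw.1⟩, h⟩
      rintro rfl
      exact hw.2 rfl
    · intro w hw
      rw [SimpleGraph.deleteEdges_adj] at hw
      refine fun h => hcon.2 w ⟨⟨?_, hw.1⟩, h⟩
      rintro rfl
      exact hw.2 Sym2.eq_swap
  have h1 := Finset.card_le_card hun
  have h2 := Finset.card_union_le (((H.neighborFinset x).erase y).image fun w => c s(x, w))
      (((H.neighborFinset y).erase x).image fun w => c s(y, w))
  have h3 : (((H.neighborFinset x).erase y).image fun w => c s(x, w)).card ≤ H.degree x - 1 := by
    refine Finset.card_image_le.trans ?_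
    rw [Finset.card_erase_of_mem (by simpa using hxy), SimpleGraph.card_neighborFinset_eq_degree]
  have h4 : (((H.neighborFinset y).erase x).image fun w => c s(y, w)).card ≤ H.degree y - 1 := by
    refine Finset.card_image_le.trans ?_
    rw [Finset.card_erase_of_mem (by simpa using hxy.symm),
      SimpleGraph.card_neighborFinset_eq_degree]
  have h5 : (Finset.univ : Finset (Fin 3)).card = 3 := rfl
  have h6 : 0 < H.degree x := (H.degree_pos_iff_exists_adj x).2 ⟨y, hxy⟩
  have h7 : 0 < H.degree y := (H.degree_pos_iff_exists_adj y).2 ⟨x, hxy.symm⟩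
  omega

/-- In a critical graph no vertex has two neighbours of degree two. -/
theorem crit_val [Fintype V] {H : SimpleGraph V} (hH : ¬ ∃ c, Prop3 H c)
    (hcrit : ∀ x y, H.Adj x y → ∃ c, Prop3 (H.deleteEdges {s(x, y)}) c)
    {x y w : V} (hyx : H.Adj y x) (hyw : H.Adj y w) (hxw : x ≠ w)
    (hdx : H.degree x = 2) (hdw : H.degree w = 2) (hdy : H.degree y = 3) : False := by
  have hxy : H.Adj x y := hyx.symm
  -- neighbours
  obtain ⟨v, hv⟩ : ∃ v, H.neighborFinset y = {x, w, v} ∧ v ≠ x ∧ v ≠ w := by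
    have h1 : (((H.neighborFinset y).erase x).erase w).card = 1 := by
      rw [Finset.card_erase_of_mem, Finset.card_erase_of_mem,
        SimpleGraph.card_neighborFinset_eq_degree, hdy]
      · simpa using hyx
      · simp [hyw, hxw.symm]
    obtain ⟨v, hv⟩ := Finset.card_eq_one.1 h1
    have hv' : v ∈ ((H.neighborFinset y).erase x).erase w := by
      rw [hv]
      simp
    simp only [Finset.mem_erase] at hv'
    refine ⟨v, ?_, hv'.2.1, hv'.1⟩
    rw [← hv, Finset.insert_erase, Finset.insert_erase]
    · simpa using hyx
    · simp [hyw, hxw.symm]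
  obtain ⟨hNy, hvx, hvw⟩ := hv
  have two_nbr : ∀ u, H.degree u = 2 → H.Adj u y →
      ∃ u', u' ≠ y ∧ ∀ t, H.Adj u t ↔ t = y ∨ t = u' := by
    intro u hu huy
    have h1 : ((H.neighborFinset u).erase y).card = 1 := by
      rw [Finset.card_erase_of_mem, SimpleGraph.card_neighborFinset_eq_degree, hu]
      simpa using huy
    obtain ⟨u', hu'⟩ := Finset.card_eq_one.1 h1
    have h2 : u' ∈ (H.neighborFinset u).erase y := by
      rw [hu']
      simp
    refine ⟨u', Finset.ne_of_mem_erase h2, ?_⟩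
    intro t
    have h3 : insert y ((H.neighborFinset u).erase y) = H.neighborFinset u :=
      Finset.insert_erase (by simpa using huy)
    rw [hu'] at h3
    rw [← SimpleGraph.mem_neighborFinset, ← h3]
    simp
  have hNy' : ∀ t, H.Adj y t ↔ t = x ∨ t = w ∨ t = v := by
    intro t
    rw [← SimpleGraph.mem_neighborFinset, hNy]
    simp
  obtain ⟨x', hx'y, hNx⟩ := two_nbr x hdx hxy
  obtain ⟨w', hw'y, hNw⟩ := two_nbr w hdw hyw.symm
  obtain ⟨c, hc⟩ := hcrit x y hxy
  set H' := H.deleteEdges {s(x, y)} with hH'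
  have hadj : ∀ p q, H'.Adj p q ↔ H.Adj p q ∧ s(p, q) ≠ s(x, y) := by
    intro p q
    rw [hH', SimpleGraph.deleteEdges_adj]
    rfl
  have hnyx : y ≠ x := hyx.ne
  have hnyw : y ≠ w := hyw.ne
  have hnyv : y ≠ v := by
    have : H.Adj y v := (hNy' v).2 (by simp)
    exact this.ne
  have h'yw : H'.Adj y w := (hadj _ _).2 ⟨hyw, by simp [hnyx, hxw.symm]⟩
  have h'yv : H'.Adj y v := (hadj _ _).2 ⟨(hNy' v).2 (by simp), by simp [hnyx, hvx]⟩
  have hNy'' : ∀ t, H'.Adj y t → t = w ∨ t = v := by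
    intro t ht
    rw [hadj, hNy'] at ht
    rcases ht.1 with rfl | h
    · exact absurd Sym2.eq_swap ht.2
    · exact h
  have hab : c s(y, w) ≠ c s(y, v) := fun h => hvw (hc y w v h'yw h'yv h).symm
  obtain ⟨c0, hc0a, hc0b⟩ := exists_third (c s(y, w)) (c s(y, v))
  have hmy : Miss H' c y c0 := by
    intro t ht h
    rcases hNy'' t ht with rfl | rfl
    · exact hc0a h.symm
    · exact hc0b h.symm
  have hNx' : ∀ t, H'.Adj x t → t = x' := by
    intro t ht
    rw [hadj, hNx] at ht
    rcases ht.1 with rfl | h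
    · exact absurd rfl ht.2
    · exact h
  have hcx : c s(x, x') = c0 := by
    by_contra hcon
    apply hH
    refine ⟨_, col_extend hxy hc (a := c0) ?_ hmy⟩
    intro t ht
    rw [hNx' t ht]
    exact hcon
  have hmxa : Miss H' c x (c s(y, w)) := by
    intro t ht
    rw [hNx' t ht, hcx]
    exact hc0a
  have hmxb : Miss H' c x (c s(y, v)) := by
    intro t ht
    rw [hNx' t ht, hcx]
    exact hc0b
  have hmwb : Miss H' c w (c s(y, v)) := by
    have hr := kempe_reach hH hxy hc hmxa hmy
    intro t ht h
    have hty : t ≠ y := by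
      rintro rfl
      rw [Sym2.eq_swap] at h
      exact hab h
    have htw' : t = w' := by
      have := (hNw t).1 ((hadj _ _).1 ht).1
      tauto
    have := reach_closed {y, w} ?_ hr (by simp)
    · rcases this with h1 | h1
      · exact hnyx h1.symm
      · exact hxw h1
    · rintro p q ⟨hpq, hcol⟩ hp
      rcases hp with rfl | hp
      · rcases hNy'' q hpq with rfl | rfl
        · simp
        · exfalso
          rcases hcol with h1 | h1
          · exact hab h1.symm
          · exact hc0b h1.symm
      · rw [Set.mem_singleton_iff] at hp
        subst hp
        have h1 := (hNw q).1 ((hadj _ _).1 hpq).1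
        rcases h1 with rfl | h1
        · simp
        · exfalso
          rw [h1, ← htw', h] at hcol
          rcases hcol with h1 | h1
          · exact hab h1.symm
          · exact hc0b h1.symm
  have hr1 := kempe_reach hH hxy hc hmxb hmy
  -- shift the uncoloured edge
  set H2 := H.deleteEdges {s(w, y)} with hH2
  have hadj2 : ∀ p q, H2.Adj p q ↔ H.Adj p q ∧ s(p, q) ≠ s(w, y) := by
    intro p q
    rw [hH2, SimpleGraph.deleteEdges_adj]
    rfl
  have hadj3 : ∀ p q, (H2.deleteEdges {s(x, y)}).Adj p q → H'.Adj p q ∧ s(p, q) ≠ s(w, y) := by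
    intro p q h
    rw [SimpleGraph.deleteEdges_adj, hadj2] at h
    exact ⟨(hadj _ _).2 ⟨h.1.1, h.2⟩, h.1.2⟩
  have hc2 : Prop3 H2 (fun e => if e = s(x, y) then c s(y, w) else c e) := by
    refine col_extend ?_ ?_ ?_ ?_
    · rw [hadj2]
      exact ⟨hxy, by simp [hxw, hnyw]⟩
    · intro p q r h1 h2 h3
      exact hc p q r (hadj3 _ _ h1).1 (hadj3 _ _ h2).1 h3
    · intro t ht
      exact hmxa t (hadj3 _ _ ht).1
    · intro t ht h
      obtain ⟨h1, h2⟩ := hadj3 _ _ ht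
      rcases hNy'' t h1 with rfl | rfl
      · exact h2 Sym2.eq_swap
      · exact hab h.symm
  have hmw2 : Miss H2 (fun e => if e = s(x, y) then c s(y, w) else c e) w (c s(y, v)) := by
    intro t ht
    have hne : s(w, t) ≠ s(x, y) := by
      simp [hxw.symm, hnyw.symm]
    simp only [hne, if_false]
    exact hmwb t ((hadj _ _).2 ⟨((hadj2 _ _).1 ht).1, hne⟩)
  have hmy2 : Miss H2 (fun e => if e = s(x, y) then c s(y, w) else c e) y c0 := by
    intro t ht
    by_cases hne : s(y, t) = s(x, y)
    · simp only [hne, if_true]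
      exact hc0a.symm
    · simp only [hne, if_false]
      exact hmy t ((hadj _ _).2 ⟨((hadj2 _ _).1 ht).1, hne⟩)
  have hr2 := kempe_reach hH hyw.symm hc2 hmw2 hmy2
  have hr3 : (kempe H' c (c s(y, v)) c0).Reachable y w := by
    refine hr2.mono ?_
    rintro p q ⟨h1, h2⟩
    have hne : s(p, q) ≠ s(x, y) := by
      intro h
      simp only [h, if_true] at h2
      rcases h2 with h2 | h2
      · exact hab h2
      · exact hc0a h2.symm
    simp only [hne, if_false] at h2
    exact ⟨(hadj _ _).2 ⟨((hadj2 _ _).1 h1).1, hne⟩, h2⟩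
  exact no_three_ends (kempe H' c (c s(y, v)) c0) (kempe_degree hc _ _) hnyx.symm hxw hnyw
    (kempe_degree_one hc _ _ _ (Or.inl hmxb)) (kempe_degree_one hc _ _ _ (Or.inr hmy))
    (kempe_degree_one hc _ _ _ (Or.inl hmwb)) hr1 hr3

/-- The number of vertices seeing a given colour is even. -/
theorem seen_even [Fintype V] {H : SimpleGraph V} {c : Sym2 V → Fin 3} (hc : Prop3 H c)
    (a : Fin 3) : Even (Finset.univ.filter fun v => ¬ Miss H c v a).card := by
  have h1 := (kempe H c a a).even_card_odd_degree_vertices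
  convert h1 using 3
  rename_i v _
  constructor
  · intro h
    simp only [Miss, not_forall, not_not] at h
    obtain ⟨w, hw, hcw⟩ := h
    have h2 : (kempe H c a a).neighborFinset v = {w} := by
      ext t
      rw [SimpleGraph.mem_neighborFinset, Finset.mem_singleton]
      constructor
      · rintro ⟨h3, h4⟩
        rw [or_self] at h4
        exact hc v t w h3 hw (h4.trans hcw.symm)
      · rintro rfl
        exact ⟨hw, Or.inl hcw⟩
    rw [← SimpleGraph.card_neighborFinset_eq_degree, h2, Finset.card_singleton]
    exact odd_one
  · intro h hm
    have h2 : (kempe H c a a).neighborFinset v = ∅ := by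
      ext t
      rw [SimpleGraph.mem_neighborFinset]
      simp only [Finset.notMem_empty, iff_false]
      rintro ⟨h3, h4⟩
      rw [or_self] at h4
      exact hm t h3 h4
    rw [← SimpleGraph.card_neighborFinset_eq_degree, h2] at h
    simp at h

theorem crossing {G : SimpleGraph V} (hb : ∀ e, ¬ G.IsBridge e) (X : Set V) {x y : V}
    (hx : x ∈ X) (hy : y ∉ X) (a b : V) :
    ∃ v w, G.Adj v w ∧ v ∈ X ∧ w ∉ X ∧ s(v, w) ≠ s(a, b) := by
  by_contra hcon
  push Not at hcon
  have key : ∀ p q, p ∈ X → q ∉ X → (∀ v w, G.Adj v w → v ∈ X → w ∉ X → s(v, w) = s(p, q)) →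
      False := by
    intro p q hp hq h
    have h1 : (G.deleteEdges {s(p, q)}).Reachable p q := by
      by_contra h2
      exact hb s(p, q) (SimpleGraph.isBridge_iff.2 h2)
    refine hq (reach_closed X ?_ h1 hp)
    intro v w hvw hv
    rw [SimpleGraph.deleteEdges_adj] at hvw
    by_contra hw
    exact hvw.2 (h v w hvw.1 hv hw)
  by_cases h1 : a ∈ X ∧ b ∉ X
  · exact key a b h1.1 h1.2 hcon
  by_cases h2 : b ∈ X ∧ a ∉ X
  · refine key b a h2.1 h2.2 fun v w h hv hw => ?_
    rw [hcon v w h hv hw, Sym2.eq_swap]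
  refine key x y hx hy fun v w h hv hw => ?_
  exfalso
  have h3 := hcon v w h hv hw
  rw [Sym2.eq_iff] at h3
  rcases h3 with ⟨rfl, rfl⟩ | ⟨rfl, rfl⟩
  · exact h1 ⟨hv, hw⟩
  · exact h2 ⟨hv, hw⟩

theorem seen_card [Fintype V] {H : SimpleGraph V} {c : Sym2 V → Fin 3} (hc : Prop3 H c) (v : V) :
    (Finset.univ.filter fun a => ¬ Miss H c v a).card = H.degree v := by
  rw [← SimpleGraph.card_neighborFinset_eq_degree,
    ← Finset.card_image_of_injOn (s := H.neighborFinset v) (f := fun w => c s(v, w))]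
  · congr 1
    ext a
    simp [Miss]
  · intro w hw w' hw' h
    simp only [Finset.mem_coe, SimpleGraph.mem_neighborFinset] at hw hw'
    exact hc v w w' hw hw' h

theorem seen_sum [Fintype V] {H : SimpleGraph V} {c : Sym2 V → Fin 3} (hc : Prop3 H c) :
    ∑ a, (Finset.univ.filter fun v => ¬ Miss H c v a).card = 2 * H.edgeFinset.card := by
  rw [← SimpleGraph.sum_degrees_eq_twice_card_edges]
  simp_rw [← seen_card hc, Finset.card_filter]
  exact Finset.sum_comm

/-- Parity obstruction: a critical graph of maximum degree three does not have exactly two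
vertices of degree two, all others having degree three. -/
theorem crit_two [Fintype V] {H : SimpleGraph V} (hH : ¬ ∃ c, Prop3 H c)
    (hcrit : ∀ x y, H.Adj x y → ∃ c, Prop3 (H.deleteEdges {s(x, y)}) c)
    (hdeg : ∀ v, H.degree v = 0 ∨ H.degree v = 2 ∨ H.degree v = 3)
    (h2 : (Finset.univ.filter fun v => H.degree v = 2).card = 2)
    {x y : V} (hxy : H.Adj x y) (hx : H.degree x = 2) (hy : H.degree y = 3) : False := by
  obtain ⟨c, hc⟩ := hcrit x y hxy
  obtain ⟨H', hH'⟩ : ∃ H', H' = H.deleteEdges {s(x, y)} := ⟨_, rfl⟩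
  rw [← hH'] at hc
  set n : Fin 3 → ℕ := fun a => (Finset.univ.filter fun v => ¬ Miss H' c v a).card with hn
  have heven : ∀ a, Even (n a) := fun a => seen_even hc a
  have hsum := seen_sum hc
  have hedge : H'.edgeFinset.card + 1 = H.edgeFinset.card := by
    have h1 : H'.edgeFinset = H.edgeFinset.erase s(x, y) := by
      ext e
      simp only [SimpleGraph.mem_edgeFinset, Finset.mem_erase, hH',
        SimpleGraph.edgeSet_deleteEdges]
      simp [and_comm]
    rw [h1]
    exact Finset.card_erase_add_one (by simpa using hxy)
  have hdegsum := H.sum_degrees_eq_twice_card_edges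
  set N := (Finset.univ.filter fun v => H.degree v ≠ 0).card with hN
  have hdeg3 : ∑ v, H.degree v + 2 = 3 * N := by
    rw [← h2, hN, Finset.card_filter, Finset.card_filter, ← Finset.sum_add_distrib,
      Finset.mul_sum]
    refine Finset.sum_congr rfl fun v _ => ?_
    rcases hdeg v with h | h | h <;> simp [h]
  have dx : H'.degree x = 1 := by
    have h1 : H'.neighborFinset x = (H.neighborFinset x).erase y := by
      ext t
      simp only [SimpleGraph.mem_neighborFinset, Finset.mem_erase, hH',
        SimpleGraph.deleteEdges_adj, Set.mem_singleton_iff, Sym2.eq_iff]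
      have := hxy.ne
      tauto
    rw [← SimpleGraph.card_neighborFinset_eq_degree, h1,
      Finset.card_erase_of_mem (by simpa using hxy), SimpleGraph.card_neighborFinset_eq_degree, hx]
  have dy : H'.degree y = 2 := by
    have h1 : H'.neighborFinset y = (H.neighborFinset y).erase x := by
      ext t
      simp only [SimpleGraph.mem_neighborFinset, Finset.mem_erase, hH',
        SimpleGraph.deleteEdges_adj, Set.mem_singleton_iff, Sym2.eq_iff]
      have := hxy.ne
      tauto
    rw [← SimpleGraph.card_neighborFinset_eq_degree, h1,
      Finset.card_erase_of_mem (by simpa using hxy.symm),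
      SimpleGraph.card_neighborFinset_eq_degree, hy]
  have hcov : ∀ a, Miss H' c x a ∨ Miss H' c y a := by
    intro a
    by_contra hcon
    push Not at hcon
    have hun : (Finset.univ.filter fun a => ¬ Miss H' c x a) ∪
        (Finset.univ.filter fun a => ¬ Miss H' c y a) = Finset.univ := by
      ext b
      simp only [Finset.mem_union, Finset.mem_filter, Finset.mem_univ, true_and, iff_true]
      by_contra hcon2
      push Not at hcon2
      exact hH ⟨_, col_extend hxy (hH' ▸ hc) (hH' ▸ hcon2.1) (hH' ▸ hcon2.2)⟩
    have h3 := Finset.card_union_add_card_inter (Finset.univ.filter fun a => ¬ Miss H' c x a)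
        (Finset.univ.filter fun a => ¬ Miss H' c y a)
    rw [hun, seen_card hc, seen_card hc, dx, dy] at h3
    have h4 : 0 < ((Finset.univ.filter fun a => ¬ Miss H' c x a) ∩
        (Finset.univ.filter fun a => ¬ Miss H' c y a)).card :=
      Finset.card_pos.2 ⟨a, by simpa using hcon⟩
    have h5 : (Finset.univ : Finset (Fin 3)).card = 3 := rfl
    omega
  have hlt : ∀ a, n a + 1 ≤ N := by
    intro a
    rw [hN, Nat.succ_le_iff]
    apply Finset.card_lt_card
    rw [Finset.ssubset_iff_of_subset]
    · rcases hcov a with h | h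
      · exact ⟨x, by simp [hx], by simpa using h⟩
      · exact ⟨y, by simp [hy], by simpa using h⟩
    · intro v hv
      simp only [Finset.mem_filter, Finset.mem_univ, true_and, Miss, not_forall] at hv ⊢
      obtain ⟨w, hw, -⟩ := hv
      have : 0 < H.degree v :=
        (H.degree_pos_iff_exists_adj v).2 ⟨w, (H.deleteEdges_le _) (hH' ▸ hw)⟩
      omega
  rw [Fin.sum_univ_three] at hsum
  have e0 := heven 0
  have e1 := heven 1
  have e2 := heven 2
  have l0 := hlt 0
  have l1 := hlt 1
  have l2 := hlt 2
  simp only [hn] at e0 e1 e2 l0 l1 l2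
  obtain ⟨r0, hr0⟩ := e0
  obtain ⟨r1, hr1⟩ := e1
  obtain ⟨r2, hr2⟩ := e2
  omega

/-- The index of the degree-two vertex attached to a given degree-three vertex. -/
def half : Fin 6 → Fin 3 := ![0, 0, 1, 1, 2, 2]

theorem crit_structure [Fintype V] {G : SimpleGraph V} (hG : IsCubic G)
    (hb : ∀ e, ¬ G.IsBridge e) (K : Set V) (hK : K.Nonempty) (hcard : (Kᶜ : Set V).ncard ≤ 10)
    {H : SimpleGraph V} (hHG : ∀ v w, H.Adj v w → G.Adj v w ∧ v ∉ K ∧ w ∉ K)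
    (hH : ¬ ∃ c, Prop3 H c)
    (hcrit : ∀ x y, H.Adj x y → ∃ c, Prop3 (H.deleteEdges {s(x, y)}) c) :
    ∃ (u : Fin 3 → V) (p : Fin 6 → V) (z : Fin 3 → V), Function.Injective u ∧
      Function.Injective p ∧ (∀ i j, u i ≠ p j) ∧ (∀ i, u i ∉ K) ∧ (∀ i, p i ∉ K) ∧
      (∀ k w, G.Adj (u k) w ↔ w = z k ∨ ∃ i, half i = k ∧ w = p i) ∧
      (∀ k j, z k ≠ u j) ∧ (∀ k i, z k ≠ p i) ∧
      (∀ i w, G.Adj (p i) w → w = u (half i) ∨ ∃ j, w = p j) ∧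
      (∀ y y', y ∉ K → y' ∉ K → (∀ i, y ≠ u i) → (∀ i, y' ≠ u i) → (∀ i, y ≠ p i) →
        (∀ i, y' ≠ p i) → y = y') := by
  have hGN : ∀ v, (G.neighborFinset v).card = 3 := by
    intro v
    rw [← hG v, Set.ncard_eq_toFinset_card']
    congr 1
  have hsub : ∀ v, H.neighborFinset v ⊆ G.neighborFinset v := by
    intro v w hw
    rw [SimpleGraph.mem_neighborFinset] at hw ⊢
    exact (hHG v w hw).1
  have hle3 : ∀ v, H.degree v ≤ 3 := by
    intro v
    rw [← SimpleGraph.card_neighborFinset_eq_degree, ← hGN v]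
    exact Finset.card_le_card (hsub v)
  have h23 : ∀ v w, H.Adj v w → H.degree v = 2 ∨ H.degree v = 3 := by
    intro v w h
    have h1 := crit_degree hH hcrit h
    have h2 := hle3 v
    have h3 := hle3 w
    omega
  have hdeg : ∀ v, H.degree v = 0 ∨ H.degree v = 2 ∨ H.degree v = 3 := by
    intro v
    rcases Nat.eq_zero_or_pos (H.degree v) with h | h
    · exact Or.inl h
    · obtain ⟨w, hw⟩ := (H.degree_pos_iff_exists_adj v).1 h
      exact Or.inr (h23 v w hw)
  have hN2 : ∀ v w, H.Adj v w → H.degree v = 2 → H.degree w = 3 := by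
    intro v w h h2
    have h1 := crit_degree hH hcrit h
    have h3 := hle3 w
    omega
  set D2 := Finset.univ.filter fun v => H.degree v = 2 with hD2
  set D3 := Finset.univ.filter fun v => H.degree v = 3 with hD3
  have mD2 : ∀ v, v ∈ D2 ↔ H.degree v = 2 := by simp [hD2]
  have mD3 : ∀ v, v ∈ D3 ↔ H.degree v = 3 := by simp [hD3]
  have hbi : D2.biUnion (fun v => H.neighborFinset v) ⊆ D3 := by
    intro w hw
    rw [Finset.mem_biUnion] at hw
    obtain ⟨v, hv, hvw⟩ := hw
    rw [SimpleGraph.mem_neighborFinset] at hvw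
    exact (mD3 w).2 (hN2 v w hvw ((mD2 v).1 hv))
  have hbic : (D2.biUnion (fun v => H.neighborFinset v)).card = 2 * D2.card := by
    rw [Finset.card_biUnion]
    · rw [Finset.sum_const_nat (m := 2), mul_comm]
      intro v hv
      rw [SimpleGraph.card_neighborFinset_eq_degree]
      exact (mD2 v).1 hv
    · intro v hv w hw hvw
      rw [Function.onFun, Finset.disjoint_left]
      intro t ht ht'
      rw [SimpleGraph.mem_neighborFinset] at ht ht'
      exact crit_val hH hcrit ht.symm ht'.symm hvw ((mD2 v).1 hv) ((mD2 w).1 hw)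
        (hN2 v t ht ((mD2 v).1 hv))
  have h2le : 2 * D2.card ≤ D3.card := by
    rw [← hbic]
    exact Finset.card_le_card hbi
  have hdis : Disjoint D2 D3 := by
    rw [Finset.disjoint_left]
    intro v h1 h2
    rw [mD2] at h1
    rw [mD3] at h2
    omega
  set Y := (Kᶜ : Set V).toFinset with hY
  have mY : ∀ v, v ∈ Y ↔ v ∉ K := by simp [hY]
  have hYc : Y.card ≤ 10 := by
    rwa [Set.ncard_eq_toFinset_card'] at hcard
  have hXY : D2 ∪ D3 ⊆ Y := by
    intro v hv
    have h1 : 0 < H.degree v := by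
      rw [Finset.mem_union, mD2, mD3] at hv
      omega
    obtain ⟨w, hw⟩ := (H.degree_pos_iff_exists_adj v).1 h1
    exact (mY v).2 (hHG v w hw).2.1
  have hXc : D2.card + D3.card ≤ 10 := by
    rw [← Finset.card_union_of_disjoint hdis]
    exact (Finset.card_le_card hXY).trans hYc
  -- an edge
  obtain ⟨x0, y0, hxy0⟩ : ∃ x y, H.Adj x y := by
    by_contra hcon
    push Not at hcon
    exact hH ⟨fun _ => 0, fun v w w' h => absurd h (hcon v w)⟩
  have hx0 : x0 ∈ D2 ∪ D3 := by
    rw [Finset.mem_union, mD2, mD3]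
    exact h23 x0 y0 hxy0
  obtain ⟨k0, hk0⟩ := hK
  have hk0X : k0 ∉ D2 ∪ D3 := fun h => (mY k0).1 (hXY h) hk0
  have hfull : ∀ v, H.degree v = 3 → ∀ w, G.Adj v w → H.Adj v w := by
    intro v hv w hw
    have h1 : H.neighborFinset v = G.neighborFinset v := by
      apply Finset.eq_of_subset_of_card_le (hsub v)
      rw [hGN, SimpleGraph.card_neighborFinset_eq_degree, hv]
    rw [← SimpleGraph.mem_neighborFinset, h1, SimpleGraph.mem_neighborFinset]
    exact hw
  have hz : ∀ v, ∃ z, H.degree v = 2 → ¬ H.Adj v z ∧ ∀ w, G.Adj v w ↔ w = z ∨ H.Adj v w := by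
    intro v
    by_cases h : H.degree v = 2
    · have h1 : (G.neighborFinset v \ H.neighborFinset v).card = 1 := by
        rw [Finset.card_sdiff_of_subset (hsub v), hGN, SimpleGraph.card_neighborFinset_eq_degree, h]
      obtain ⟨z, hz⟩ := Finset.card_eq_one.1 h1
      have h2 : ∀ w, (G.Adj v w ∧ ¬ H.Adj v w) ↔ w = z := by
        intro w
        have := Finset.ext_iff.1 hz w
        simpa using this
      refine ⟨z, fun _ => ⟨((h2 z).2 rfl).2, ?_⟩⟩
      intro w
      rw [← h2 w]
      have := fun h => (hHG v w h).1
      tauto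
    · exact ⟨v, fun h' => absurd h' h⟩
  choose z hz using hz
  have hcross : ∀ v w, G.Adj v w → v ∈ D2 ∪ D3 → w ∉ D2 ∪ D3 → v ∈ D2 ∧ w = z v := by
    intro v w hvw hv hw
    have hnH : ¬ H.Adj v w := by
      intro h
      apply hw
      rw [Finset.mem_union, mD2, mD3]
      exact h23 w v h.symm
    rw [Finset.mem_union] at hv
    rcases hv with hv | hv
    · refine ⟨hv, ?_⟩
      have h1 := ((hz v ((mD2 v).1 hv)).2 w).1 hvw
      exact h1.resolve_right hnH
    · exact absurd (hfull v ((mD3 v).1 hv) w hvw) hnH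
  have hcr : ∀ a b, ∃ v ∈ D2, z v ∉ D2 ∪ D3 ∧ s(v, z v) ≠ s(a, b) := by
    intro a b
    obtain ⟨v, w, h1, h2, h3, h4⟩ := crossing hb (↑(D2 ∪ D3) : Set V) (Finset.mem_coe.2 hx0)
      (fun h => hk0X (Finset.mem_coe.1 h)) a b
    rw [Finset.mem_coe] at h2 h3
    obtain ⟨h5, rfl⟩ := hcross v w h1 h2 h3
    exact ⟨v, h5, h3, h4⟩
  -- the number of degree-two vertices
  have hne0 : D2.card ≠ 0 := by
    intro h
    rw [Finset.card_eq_zero] at h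
    obtain ⟨v, hv, -⟩ := hcr x0 x0
    rw [h] at hv
    exact absurd hv (Finset.notMem_empty v)
  have hne1 : D2.card ≠ 1 := by
    intro h
    obtain ⟨t, ht⟩ := Finset.card_eq_one.1 h
    obtain ⟨v, hv, -, h3⟩ := hcr t (z t)
    rw [ht, Finset.mem_singleton] at hv
    rw [hv] at h3
    exact h3 rfl
  have hne2 : D2.card ≠ 2 := by
    intro h
    obtain ⟨x, hx⟩ := Finset.card_pos.1 (Nat.pos_of_ne_zero hne0)
    rw [mD2] at hx
    obtain ⟨y, hy⟩ := (H.degree_pos_iff_exists_adj x).1 (by omega)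
    exact crit_two hH hcrit hdeg h hy hx (hN2 x y hy hx)
  have hD2c : D2.card = 3 := by omega
  have hpar : 2 * D2.card + 3 * D3.card = 2 * H.edgeFinset.card := by
    rw [← SimpleGraph.sum_degrees_eq_twice_card_edges, hD2, hD3, Finset.card_filter,
      Finset.card_filter, Finset.mul_sum, Finset.mul_sum, ← Finset.sum_add_distrib]
    refine Finset.sum_congr rfl fun v _ => ?_
    rcases hdeg v with h | h | h <;> simp [h]
  have hD3c : D3.card = 6 := by omega
  have hbieq : D2.biUnion (fun v => H.neighborFinset v) = D3 :=
    Finset.eq_of_subset_of_card_le hbi (by omega)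
  -- names
  obtain ⟨u0, u1, u2, h01, h02, h12, hu⟩ := Finset.card_eq_three.1 hD2c
  have du : ∀ v ∈ D2, ∃ a b, a ≠ b ∧ ∀ w, H.Adj v w ↔ w = a ∨ w = b := by
    intro v hv
    rw [mD2, ← SimpleGraph.card_neighborFinset_eq_degree] at hv
    obtain ⟨a, b, hab, h⟩ := Finset.card_eq_two.1 hv
    refine ⟨a, b, hab, fun w => ?_⟩
    rw [← SimpleGraph.mem_neighborFinset, h]
    simp
  have m0 : u0 ∈ D2 := by simp [hu]
  have m1 : u1 ∈ D2 := by simp [hu]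
  have m2 : u2 ∈ D2 := by simp [hu]
  obtain ⟨a0, b0, hab0, N0⟩ := du u0 m0
  obtain ⟨a1, b1, hab1, N1⟩ := du u1 m1
  obtain ⟨a2, b2, hab2, N2⟩ := du u2 m2
  have hdisj : ∀ v ∈ D2, ∀ w ∈ D2, ∀ t, H.Adj v t → H.Adj w t → v = w := by
    intro v hv w hw t h1 h2
    by_contra hvw
    exact crit_val hH hcrit h1.symm h2.symm hvw ((mD2 v).1 hv) ((mD2 w).1 hw)
      (hN2 v t h1 ((mD2 v).1 hv))
  let u : Fin 3 → V := ![u0, u1, u2]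
  let p : Fin 6 → V := ![a0, b0, a1, b1, a2, b2]
  have huD : ∀ k, u k ∈ D2 := by
    intro k
    fin_cases k
    · exact m0
    · exact m1
    · exact m2
  have hDu : ∀ v ∈ D2, ∃ k, v = u k := by
    intro v hv
    rw [hu] at hv
    simp only [Finset.mem_insert, Finset.mem_singleton] at hv
    rcases hv with h | h | h
    · exact ⟨0, h⟩
    · exact ⟨1, h⟩
    · exact ⟨2, h⟩
  have hui : Function.Injective u := by
    intro i j h
    fin_cases i <;> fin_cases j <;> first
      | rfl
      | exact absurd h h01
      | exact absurd h h02
      | exact absurd h h12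
      | exact absurd h.symm h01
      | exact absurd h.symm h02
      | exact absurd h.symm h12
  have hup : ∀ k w, H.Adj (u k) w ↔ ∃ i, half i = k ∧ w = p i := by
    intro k w
    fin_cases k
    · refine (N0 w).trans ⟨?_, ?_⟩
      · rintro (h | h)
        · exact ⟨0, rfl, h⟩
        · exact ⟨1, rfl, h⟩
      · rintro ⟨i, hi, h⟩
        fin_cases i <;> first
          | exact Or.inl h
          | exact Or.inr h
          | exact absurd hi (by decide)
    · refine (N1 w).trans ⟨?_, ?_⟩
      · rintro (h | h)
        · exact ⟨2, rfl, h⟩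
        · exact ⟨3, rfl, h⟩
      · rintro ⟨i, hi, h⟩
        fin_cases i <;> first
          | exact absurd hi (by decide)
          | exact Or.inl h
          | exact Or.inr h
    · refine (N2 w).trans ⟨?_, ?_⟩
      · rintro (h | h)
        · exact ⟨4, rfl, h⟩
        · exact ⟨5, rfl, h⟩
      · rintro ⟨i, hi, h⟩
        fin_cases i <;> first
          | exact absurd hi (by decide)
          | exact Or.inl h
          | exact Or.inr h
  have hupa : ∀ i, H.Adj (u (half i)) (p i) := fun i => (hup _ _).2 ⟨i, rfl, rfl⟩
  have hp3 : ∀ i, p i ∈ D3 := by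
    intro i
    exact (mD3 _).2 (hN2 _ _ (hupa i) ((mD2 _).1 (huD _)))
  have hDp : ∀ w ∈ D3, ∃ i, w = p i := by
    intro w hw
    rw [← hbieq, Finset.mem_biUnion] at hw
    obtain ⟨v, hv, hvw⟩ := hw
    rw [SimpleGraph.mem_neighborFinset] at hvw
    obtain ⟨k, rfl⟩ := hDu v hv
    obtain ⟨i, -, hi⟩ := (hup k w).1 hvw
    exact ⟨i, hi⟩
  have hpi : Function.Injective p := by
    have himg : Finset.univ.image p = D3 := by
      ext w
      simp only [Finset.mem_image, Finset.mem_univ, true_and]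
      constructor
      · rintro ⟨i, rfl⟩
        exact hp3 i
      · intro h
        obtain ⟨i, hi⟩ := hDp w h
        exact ⟨i, hi.symm⟩
    have h1 : (Finset.univ.image p).card = (Finset.univ : Finset (Fin 6)).card := by
      rw [himg, hD3c]
      rfl
    have h2 := Finset.card_image_iff.1 h1
    intro i j h
    exact h2 (by simp) (by simp) h
  have hune : ∀ i j, u i ≠ p j := by
    intro i j h
    have h1 := huD i
    rw [h] at h1
    exact Finset.disjoint_left.1 hdis h1 (hp3 j)
  have hzu : ∀ k w, G.Adj (u k) w ↔ w = z (u k) ∨ H.Adj (u k) w :=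
    fun k => (hz (u k) ((mD2 _).1 (huD k))).2
  have hzn : ∀ k, ¬ H.Adj (u k) (z (u k)) := fun k => (hz (u k) ((mD2 _).1 (huD k))).1
  have hzG : ∀ k, G.Adj (u k) (z (u k)) := fun k => (hzu k _).2 (Or.inl rfl)
  refine ⟨u, p, fun k => z (u k), hui, hpi, hune, ?_, ?_, ?_, ?_, ?_, ?_, ?_⟩
  · intro i
    exact (mY _).1 (hXY (Finset.mem_union_left _ (huD i)))
  · intro i
    exact (mY _).1 (hXY (Finset.mem_union_right _ (hp3 i)))
  · intro k w
    rw [hzu, hup]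
  · intro k j hkj
    change z (u k) = u j at hkj
    have hkj' : k ≠ j := by
      rintro rfl
      exact (hzG k).ne hkj.symm
    have hzj : z (u j) = u k := by
      have h1 : G.Adj (u j) (u k) := by
        have := hzG k
        rw [hkj] at this
        exact this.symm
      rcases (hzu j _).1 h1 with h | h
      · exact h.symm
      · exfalso
        have h2 := hN2 _ _ h ((mD2 _).1 (huD j))
        have h3 := (mD2 _).1 (huD k)
        omega
    obtain ⟨m, hmk, hmj⟩ := exists_third k j
    obtain ⟨v, hv, h1, h2⟩ := hcr (u m) (z (u m))
    obtain ⟨i, rfl⟩ := hDu v hv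
    rcases fin3_cases (d := i) hkj' hmk hmj with rfl | rfl | rfl
    · rw [hkj] at h1
      exact h1 (Finset.mem_union_left _ (huD j))
    · rw [hzj] at h1
      exact h1 (Finset.mem_union_left _ (huD k))
    · exact h2 rfl
  · intro k i hki
    change z (u k) = p i at hki
    apply hzn k
    have h1 := hzG k
    rw [hki] at h1 ⊢
    exact (hfull _ ((mD3 _).1 (hp3 i)) _ h1.symm).symm
  · intro i w hw
    have h1 := hfull _ ((mD3 _).1 (hp3 i)) _ hw
    rcases h23 w _ h1.symm with h | h
    · left
      exact hdisj w ((mD2 _).2 h) _ (huD _) (p i) h1.symm (hupa i)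
    · right
      exact hDp w ((mD3 _).2 h)
  · intro y y' hy hy' h1 h1' h2 h2'
    have hmem : ∀ t, t ∉ K → (∀ i, t ≠ u i) → (∀ i, t ≠ p i) → t ∈ Y \ (D2 ∪ D3) := by
      intro t ht ha hb
      rw [Finset.mem_sdiff, Finset.mem_union]
      refine ⟨(mY t).2 ht, ?_⟩
      rintro (h | h)
      · obtain ⟨k, hk⟩ := hDu t h
        exact ha k hk
      · obtain ⟨k, hk⟩ := hDp t h
        exact hb k hk
    have hc1 : (Y \ (D2 ∪ D3)).card ≤ 1 := by
      rw [Finset.card_sdiff_of_subset hXY, Finset.card_union_of_disjoint hdis]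
      omega
    exact Finset.card_le_one.1 hc1 _ (hmem y hy h1 h2) _ (hmem y' hy' h1' h2')

def tab {α : Type} (d a01 a02 a03 a04 a05 a12 a13 a14 a15 a23 a24 a25 a34 a35 a45 : α) : Fin 6 → Fin 6 → α :=
  ![![d, a01, a02, a03, a04, a05],
    ![a01, d, a12, a13, a14, a15],
    ![a02, a12, d, a23, a24, a25],
    ![a03, a13, a23, d, a34, a35],
    ![a04, a14, a24, a34, d, a45],
    ![a05, a15, a25, a35, a45, d]]

/-- Exactly two of five booleans hold. -/
def two5 (a b c d e : Bool) : Bool :=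
  (a.toNat + b.toNat + c.toNat + d.toNat + e.toNat) == 2

/-- Twelve universal labellings. -/
def labels : List (Fin 6 → Fin 6 → Fin 4) :=
  [tab 0 0 2 3 1 3 2 3 1 3 3 3 3 3 0 3,
   tab 0 3 2 0 2 0 1 1 1 0 1 1 2 1 0 3,
   tab 0 0 2 2 0 0 0 0 1 1 3 3 0 0 3 2,
   tab 0 0 0 2 2 0 0 1 0 1 1 1 1 0 2 3,
   tab 0 3 3 1 0 1 0 2 2 3 1 0 1 3 2 3,
   tab 0 0 3 2 2 1 2 3 2 1 3 0 2 0 2 2,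
   tab 0 0 1 0 0 1 2 0 0 2 3 2 3 3 1 2,
   tab 0 0 0 2 1 2 1 2 0 1 3 0 0 2 1 2,
   tab 0 0 2 3 3 2 3 0 3 1 0 2 3 0 3 0,
   tab 0 0 0 1 1 0 0 0 2 2 1 1 2 2 0 0,
   tab 0 0 2 1 0 2 2 1 0 2 0 2 1 0 0 2]

/-- Does the colour `l` occur at `i`? -/
def hasLab (W : Fin 6 → Fin 6 → Bool) (L : Fin 6 → Fin 6 → Fin 4) (i : Fin 6) (l : Fin 4) : Bool :=
  (List.finRange 6).any fun j => W i j && (L i j == l)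

/-- The check for a labelling. -/
def okLab (W : Fin 6 → Fin 6 → Bool) (L : Fin 6 → Fin 6 → Fin 4) : Bool :=
  ((List.finRange 6).all fun i => (List.finRange 6).all fun j => L i j == L j i) &&
  ((List.finRange 6).all fun i => (List.finRange 6).all fun j => !W i j ||
    (List.finRange 6).all fun j' => !W i j' || !(L i j == L i j') || (j == j')) &&
  ((List.finRange 4).all fun l =>
    ((hasLab W L 0 l ^^ hasLab W L 1 l) == (l != 0 && l != 3)) &&
    ((hasLab W L 2 l ^^ hasLab W L 3 l) == (l != 1 && l != 3)) &&
    ((hasLab W L 4 l ^^ hasLab W L 5 l) == (l != 2 && l != 3)))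

theorem comb_check :
    ∀ a01 a02 a03 a04 a05 : Bool, two5 a01 a02 a03 a04 a05 = true →
    ∀ a12 a13 a14 a15 : Bool, two5 a01 a12 a13 a14 a15 = true →
    ∀ a23 a24 a25 : Bool, two5 a02 a12 a23 a24 a25 = true →
    ∀ a34 a35 : Bool, two5 a03 a13 a23 a34 a35 = true →
    ∀ a45 : Bool, two5 a04 a14 a24 a34 a45 = true →
    two5 a05 a15 a25 a35 a45 = true →
    labels.any (okLab (tab false a01 a02 a03 a04 a05 a12 a13 a14 a15 a23 a24 a25 a34 a35 a45)) = true := by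
  decide +kernel

theorem comb_two5 (f : Fin 6 → Bool) (hf : (Finset.univ.filter fun j => f j = true).card = 2) :
    (f 0).toNat + (f 1).toNat + (f 2).toNat + (f 3).toNat + (f 4).toNat + (f 5).toNat = 2 := by
  rw [← hf, Finset.card_filter, Fin.sum_univ_six]
  simp only [Bool.toNat, Bool.cond_eq_ite]

theorem odd_help (k l : Fin 4) (x y : Bool) (h : (x ^^ y) = (l != k && l != 3)) :
    Odd ((if x = true then 1 else 0) + (if y = true then 1 else 0)) ↔ (l ≠ k ∧ l ≠ 3) := by
  have h1 : (l ≠ k ∧ l ≠ 3) ↔ (l != k && l != 3) = true := by simp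
  rw [h1, ← h]
  cases x <;> cases y <;> simp

theorem comb (W : Fin 6 → Fin 6 → Prop) (hs : ∀ i j, W i j → W j i) (hi : ∀ i, ¬ W i i)
    (hd : ∀ i, (Finset.univ.filter fun j => W i j).card = 2) :
    ∃ L : Fin 6 → Fin 6 → Fin 4, (∀ i j, L i j = L j i) ∧
      (∀ i j j', W i j → W i j' → L i j = L i j' → j = j') ∧
      ∀ (k : Fin 3) (l : Fin 4), Odd (Finset.univ.filter fun i => half i = k ∧
        ∃ j, W i j ∧ L i j = l).card ↔ (l ≠ k.castSucc ∧ l ≠ 3) := by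
  let B : Fin 6 → Fin 6 → Bool := fun i j => decide (W i j)
  have hB : ∀ i j, B i j = true ↔ W i j := fun i j => by simp [B]
  have hBs : ∀ i j, B i j = B j i := by
    intro i j
    rw [Bool.eq_iff_iff, hB, hB]
    exact ⟨hs i j, hs j i⟩
  have hBi : ∀ i, B i i = false := fun i => by simp [B, hi]
  have hsum : ∀ i, (B i 0).toNat + (B i 1).toNat + (B i 2).toNat + (B i 3).toNat + (B i 4).toNat +
      (B i 5).toNat = 2 := by
    intro i
    refine comb_two5 (B i) ?_
    rw [← hd i]
    simp only [hB]
  have hBt : B = tab false (B 0 1) (B 0 2) (B 0 3) (B 0 4) (B 0 5) (B 1 2) (B 1 3) (B 1 4) (B 1 5)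
      (B 2 3) (B 2 4) (B 2 5) (B 3 4) (B 3 5) (B 4 5) := by
    funext i j
    fin_cases i <;> fin_cases j <;> first
      | exact hBi _
      | rfl
      | exact hBs _ _
  have hcheck := comb_check (B 0 1) (B 0 2) (B 0 3) (B 0 4) (B 0 5) (by
      have := hsum 0
      simp only [hBi, Bool.toNat_false] at this
      simp only [two5, beq_iff_eq]
      omega) (B 1 2) (B 1 3) (B 1 4) (B 1 5) (by
      have := hsum 1
      simp only [hBi, Bool.toNat_false, hBs 1 0] at this
      simp only [two5, beq_iff_eq]
      omega) (B 2 3) (B 2 4) (B 2 5) (by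
      have := hsum 2
      simp only [hBi, Bool.toNat_false, hBs 2 0, hBs 2 1] at this
      simp only [two5, beq_iff_eq]
      omega) (B 3 4) (B 3 5) (by
      have := hsum 3
      simp only [hBi, Bool.toNat_false, hBs 3 0, hBs 3 1, hBs 3 2] at this
      simp only [two5, beq_iff_eq]
      omega) (B 4 5) (by
      have := hsum 4
      simp only [hBi, Bool.toNat_false, hBs 4 0, hBs 4 1, hBs 4 2, hBs 4 3] at this
      simp only [two5, beq_iff_eq]
      omega) (by
      have := hsum 5
      simp only [hBi, Bool.toNat_false, hBs 5 0, hBs 5 1, hBs 5 2, hBs 5 3, hBs 5 4] at this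
      simp only [two5, beq_iff_eq]
      omega)
  rw [← hBt, List.any_eq_true] at hcheck
  obtain ⟨L, -, hL⟩ := hcheck
  simp only [okLab, Bool.and_eq_true, List.all_eq_true, List.mem_finRange, true_implies,
    beq_iff_eq, Bool.or_eq_true, Bool.not_eq_true'] at hL
  obtain ⟨⟨h1, h2⟩, h3⟩ := hL
  refine ⟨L, h1, ?_, ?_⟩
  · intro i j j' hj hj' h
    rcases h2 i j with h4 | h4
    · rw [(hB i j).2 hj] at h4
      exact absurd h4 (by decide)
    · rcases h4 j' with (h5 | h5) | h5
      · rw [(hB i j').2 hj'] at h5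
        exact absurd h5 (by decide)
      · rw [h] at h5
        simp at h5
      · exact h5
  · intro k l
    have hhas : ∀ i, (∃ j, W i j ∧ L i j = l) ↔ hasLab B L i l = true := by
      intro i
      simp [hasLab, hB]
    simp only [hhas]
    obtain ⟨⟨g0, g1⟩, g2⟩ := h3 l
    rw [Finset.card_filter, Fin.sum_univ_six]
    fin_cases k
    · have : (half 0 = 0 ∧ half 1 = 0) ∧ half 2 ≠ 0 ∧ half 3 ≠ 0 ∧ half 4 ≠ 0 ∧ half 5 ≠ 0 := by
        decide
      simp only [Fin.zero_eta, this, true_and, false_and, if_false, add_zero, zero_add]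
      rw [show ((0 : Fin 3).castSucc : Fin 4) = 0 from rfl]
      generalize hasLab B L 0 l = x at g0 ⊢
      generalize hasLab B L 1 l = y at g0 ⊢
      exact odd_help _ l _ _ g0
    · have : (half 2 = 1 ∧ half 3 = 1) ∧ half 0 ≠ 1 ∧ half 1 ≠ 1 ∧ half 4 ≠ 1 ∧ half 5 ≠ 1 := by
        decide
      simp only [Fin.mk_one, this, true_and, false_and, if_false, add_zero, zero_add]
      rw [show ((1 : Fin 3).castSucc : Fin 4) = 1 from rfl]
      generalize hasLab B L 2 l = x at g1 ⊢
      generalize hasLab B L 3 l = y at g1 ⊢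
      exact odd_help _ l _ _ g1
    · have : (half 4 = 2 ∧ half 5 = 2) ∧ half 0 ≠ 2 ∧ half 1 ≠ 2 ∧ half 2 ≠ 2 ∧ half 3 ≠ 2 := by
        decide
      simp only [Fin.reduceFinMk, this, true_and, false_and, if_false, add_zero, zero_add]
      rw [show ((2 : Fin 3).castSucc : Fin 4) = 2 from rfl]
      generalize hasLab B L 4 l = x at g2 ⊢
      generalize hasLab B L 5 l = y at g2 ⊢
      exact odd_help _ l _ _ g2

theorem f4_three {F : Type*} [Field F] [Fintype F] (h4 : Fintype.card F = 4) :
    ∃ γ : Fin 3 → F, Function.Injective γ ∧ (∀ k, γ k ≠ 0) ∧ γ 0 + γ 1 + γ 2 = 0 := by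
  obtain ⟨x, hx⟩ : ∃ x : F, x ∉ ({0, 1} : Finset F) := by
    by_contra hcon
    push Not at hcon
    have h1 : (Finset.univ : Finset F) ⊆ {0, 1} := fun x _ => hcon x
    have h2 := (Finset.card_le_card h1).trans Finset.card_le_two
    rw [Finset.card_univ, h4] at h2
    omega
  simp only [Finset.mem_insert, Finset.mem_singleton, not_or] at hx
  have h2 := f4_two h4 (1 : F)
  have h3 := f4_two h4 x
  have h5 : x + 1 ≠ 0 := by
    intro h
    apply hx.2
    linear_combination h - h2
  have a1 : (1 : F) ≠ x := fun h => hx.2 h.symm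
  have a2 : (1 : F) ≠ x + 1 := fun h => hx.1 (by linear_combination -h)
  have a3 : x ≠ x + 1 := by simp
  refine ⟨![1, x, x + 1], ?_, ?_, ?_⟩
  · intro i j h
    fin_cases i <;> fin_cases j <;> first
      | rfl
      | exact absurd h a1
      | exact absurd h a2
      | exact absurd h a3
      | exact absurd h.symm a1
      | exact absurd h.symm a2
      | exact absurd h.symm a3
  · intro k
    fin_cases k
    · exact one_ne_zero
    · exact hx.1
    · exact h5
  · change 1 + x + (x + 1) = 0
    linear_combination h2 + h3

theorem code_equiv {F : Type*} [Fintype F] (h4 : Fintype.card F = 4) (P : Fin 3 → F → Prop)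
    (h2 : ∀ k, (Finset.univ.filter fun z => P k z).card = 2)
    (he : ∀ z, Even (Finset.univ.filter fun k => P k z).card) :
    ∃ code : F → Fin 4, (∀ l, (Finset.univ.filter fun z => code z = l).card = 1) ∧
      ∀ k z, P k z ↔ (code z ≠ k.castSucc ∧ code z ≠ 3) := by
  have hp : ∀ z, (P 0 z ∧ P 1 z ∧ ¬ P 2 z) ∨ (P 0 z ∧ ¬ P 1 z ∧ P 2 z) ∨
      (¬ P 0 z ∧ P 1 z ∧ P 2 z) ∨ (¬ P 0 z ∧ ¬ P 1 z ∧ ¬ P 2 z) := by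
    intro z
    have h := he z
    rw [Finset.card_filter, Fin.sum_univ_three] at h
    by_cases a : P 0 z <;> by_cases b : P 1 z <;> by_cases c : P 2 z <;>
      simp [a, b, c, Nat.even_iff] at h ⊢
  let code : F → Fin 4 := fun z => if P 0 z then (if P 1 z then 2 else 1) else
    (if P 1 z then 0 else 3)
  have hcode : ∀ k z, P k z ↔ (code z ≠ k.castSucc ∧ code z ≠ 3) := by
    intro k z
    have h3 : ∀ k : Fin 3, k = 0 ∨ k = 1 ∨ k = 2 := by decide
    rcases hp z with ⟨a, b, c⟩ | ⟨a, b, c⟩ | ⟨a, b, c⟩ | ⟨a, b, c⟩ <;>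
      rcases h3 k with rfl | rfl | rfl <;> simp only [code, a, b, c, if_true, if_false] <;> decide
  refine ⟨code, ?_, hcode⟩
  set n : Fin 4 → ℕ := fun l => (Finset.univ.filter fun z => code z = l).card with hn
  have hsum : n 0 + n 1 + n 2 + n 3 = 4 := by
    refine Eq.trans ?_ h4
    rw [← Finset.card_univ, Finset.card_eq_sum_card_fiberwise (f := code) (t := Finset.univ)
      (fun _ _ => Finset.mem_univ _), Fin.sum_univ_four]
  have hpair : ∀ (k : Fin 3) (a b : Fin 4), a ≠ b →
      (∀ l : Fin 4, (l ≠ k.castSucc ∧ l ≠ 3) ↔ l = a ∨ l = b) → n a + n b = 2 := by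
    intro k a b hab hl
    rw [← h2 k, hn]
    simp only
    rw [← Finset.card_union_of_disjoint]
    · congr 1
      ext z
      simp only [Finset.mem_union, Finset.mem_filter, Finset.mem_univ, true_and]
      rw [hcode, hl]
    · rw [Finset.disjoint_left]
      intro z h1 h2
      simp only [Finset.mem_filter, Finset.mem_univ, true_and] at h1 h2
      exact hab (h1.symm.trans h2)
  have e0 := hpair 0 1 2 (by decide) (by decide)
  have e1 := hpair 1 0 2 (by decide) (by decide)
  have e2 := hpair 2 0 1 (by decide) (by decide)
  have hl : ∀ l : Fin 4, l = 0 ∨ l = 1 ∨ l = 2 ∨ l = 3 := by decide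
  intro l
  change n l = 1
  rcases hl l with rfl | rfl | rfl | rfl <;> omega

theorem even_pair {Q : V → Prop} {a b : V} (hab : a ≠ b) (hQ : ∀ w, Q w → w = a ∨ w = b)
    (he : Even {w | Q w}.ncard) : Q a ↔ Q b := by
  by_contra hcon
  have key : ∀ x y : V, (∀ w, Q w → w = x ∨ w = y) → Q x → ¬ Q y → False := by
    intro x y h hx hy
    have h1 : {w | Q w} = {x} := by
      ext w
      constructor
      · intro hw
        rcases h w hw with rfl | rfl
        · rfl
        · exact absurd hw hy
      · intro hw
        rw [Set.mem_singleton_iff] at hw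
        rw [hw]
        exact hx
    rw [h1, Set.ncard_singleton] at he
    exact absurd he (by decide)
  by_cases ha : Q a
  · exact key a b hQ ha (by tauto)
  · exact key b a (fun w hw => (hQ w hw).symm) (by tauto) ha

theorem nine_flow {F : Type*} [Field F] [Fintype F] (h4 : Fintype.card F = 4) [Fintype V]
    (G : SimpleGraph V) (hG : IsCubic G) (C : G.Subgraph) (hC : IsCycleSub C)
    (u : Fin 3 → V) (p : Fin 6 → V) (z : Fin 3 → V) (hu : Function.Injective u)
    (hup : ∀ i j, u i ≠ p j) (huK : ∀ i, u i ∉ C.verts)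
    (hpK : ∀ i, p i ∉ C.verts)
    (hGu : ∀ k w, G.Adj (u k) w ↔ w = z k ∨ ∃ i, half i = k ∧ w = p i)
    (hzu : ∀ k j, z k ≠ u j) (hzp : ∀ k i, z k ≠ p i)
    (hGp : ∀ i w, G.Adj (p i) w → w = u (half i) ∨ ∃ j, w = p j)
    (hone : ∀ y y', y ∉ C.verts → y' ∉ C.verts → (∀ i, y ≠ u i) → (∀ i, y' ≠ u i) →
      (∀ i, y ≠ p i) → (∀ i, y' ≠ p i) → y = y')
    (X : Set V) (hX : ∀ v, v ∈ X ↔ (∃ k, v = u k) ∨ ∃ i, v = p i) :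
    ∃ (S : F → Set (Sym2 V)) (code : F → Fin 4),
      (∀ x v w, v ∉ X → s(v, w) ∈ S x → G.Adj v w) ∧
      (∀ e ∈ C.edgeSet, (Finset.univ.filter fun x => e ∈ S x).card = 1) ∧
      (∀ v w, G.Adj v w → ¬ C.Adj v w → v ∉ X →
        (Finset.univ.filter fun x => s(v, w) ∈ S x).card = 2) ∧
      (∀ x, EvenEdgeSet (S x)) ∧
      (∀ l, (Finset.univ.filter fun x => code x = l).card = 1) ∧
      ∀ k x, s(u k, z k) ∈ S x ↔ (code x ≠ k.castSucc ∧ code x ≠ 3) := by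
  obtain ⟨n1, n2, l, hset⟩ := cycle_setup hG hC
  obtain ⟨γ, hγi, hγ0, hγs⟩ := f4_three h4
  have huX : ∀ k, u k ∈ X := fun k => (hX _).2 (Or.inl ⟨k, rfl⟩)
  have hpX : ∀ i, p i ∈ X := fun i => (hX _).2 (Or.inr ⟨i, rfl⟩)
  have hzX : ∀ k, z k ∉ X := by
    intro k h
    rcases (hX _).1 h with ⟨j, hj⟩ | ⟨j, hj⟩
    · exact hzu k j hj
    · exact hzp k j hj
  have hXK : ∀ v ∈ X, v ∉ C.verts := by
    intro v hv
    rcases (hX _).1 hv with ⟨j, rfl⟩ | ⟨j, rfl⟩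
    · exact huK j
    · exact hpK j
  let J : SimpleGraph V :=
    { Adj := fun v w => (G.Adj v w ∧ ¬ C.Adj v w ∧ (v ∉ X ∨ w ∉ X)) ∨
        (v = p 0 ∧ ∃ k, w = u k) ∨ (w = p 0 ∧ ∃ k, v = u k)
      symm := ⟨by
        rintro v w (⟨h1, h2, h3⟩ | h | h)
        · exact Or.inl ⟨h1.symm, fun h => h2 h.symm, h3.symm⟩
        · exact Or.inr (Or.inr h)
        · exact Or.inr (Or.inl h)⟩
      loopless := ⟨by
        rintro v (⟨h1, -⟩ | ⟨h1, k, h2⟩ | ⟨h1, k, h2⟩)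
        · exact h1.ne rfl
        · exact hup k 0 (h2.symm.trans h1)
        · exact hup k 0 (h2.symm.trans h1)⟩ }
  have hJo : ∀ v ∉ X, ∀ w, J.Adj v w ↔ G.Adj v w ∧ ¬ C.Adj v w := by
    intro v hv w
    constructor
    · rintro (⟨h1, h2, h3⟩ | ⟨h1, k, h2⟩ | ⟨h1, k, h2⟩)
      · exact ⟨h1, h2⟩
      · exact absurd (h1 ▸ hpX 0) hv
      · exact absurd (h2 ▸ huX k) hv
    · rintro ⟨h1, h2⟩
      exact Or.inl ⟨h1, h2, Or.inl hv⟩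
  have hJu : ∀ k w, J.Adj (u k) w ↔ w = z k ∨ w = p 0 := by
    intro k w
    constructor
    · rintro (⟨h1, h2, h3⟩ | ⟨h1, j, h2⟩ | ⟨h1, j, h2⟩)
      · left
        rcases (hGu k w).1 h1 with h | ⟨i, -, hi⟩
        · exact h
        · rcases h3 with h3 | h3
          · exact absurd (huX k) h3
          · exact absurd (hi ▸ hpX i) h3
      · exact absurd h1 (hup k 0)
      · exact Or.inr h1
    · rintro (h | h)
      · rw [h]
        exact Or.inl ⟨(hGu k _).2 (Or.inl rfl), fun h => huK k (C.edge_vert h), Or.inr (hzX k)⟩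
      · exact Or.inr (Or.inr ⟨h, k, rfl⟩)
  have hJp : ∀ i w, J.Adj (p i) w → p i = p 0 ∧ ∃ k, w = u k := by
    rintro i w (⟨h1, h2, h3⟩ | h | ⟨h1, j, h2⟩)
    · exfalso
      rcases h3 with h3 | h3
      · exact h3 (hpX i)
      · rcases hGp i w h1 with h | ⟨j, h⟩
        · exact h3 (h ▸ huX _)
        · exact h3 (h ▸ hpX j)
    · exact h
    · exact absurd h2.symm (hup j i)
  -- colours
  let c : Sym2 V → F := fun e => if u 0 ∈ e then γ 0 else if u 1 ∈ e then γ 1 else γ 2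
  have hc0 : ∀ e, c e ≠ 0 := by
    intro e
    simp only [c]
    split_ifs
    · exact hγ0 0
    · exact hγ0 1
    · exact hγ0 2
  have hcu : ∀ k v, (∀ j, v ≠ u j) → c s(v, u k) = γ k := by
    intro k v hv
    have hmem : ∀ j, u j ∈ s(v, u k) ↔ j = k := by
      intro j
      rw [Sym2.mem_iff]
      constructor
      · rintro (h | h)
        · exact absurd h.symm (hv j)
        · exact hu h
      · rintro rfl
        exact Or.inr rfl
    simp only [c, hmem]
    have h3 : ∀ k : Fin 3, k = 0 ∨ k = 1 ∨ k = 2 := by decide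
    rcases h3 k with rfl | rfl | rfl
    · simp
    · simp
    · simp
  have hQX : ∀ r w, r ∉ C.verts → r ∉ X → J.Adj r w → w ∈ X → ∃ k, w = u k := by
    intro r w hr hrX h hw
    rcases (hX w).1 hw with h1 | ⟨i, rfl⟩
    · exact h1
    · obtain ⟨-, k, hk⟩ := hJp i r h.symm
      exact absurd (hk ▸ huX k) hrX
  have hnX : ∀ v, v ∉ X → (∀ k, v ≠ u k) ∧ ∀ i, v ≠ p i := by
    intro v hv
    exact ⟨fun k h => hv (h ▸ huX k), fun i h => hv (h ▸ hpX i)⟩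
  obtain ⟨g, hg, hgP, hg0⟩ := flow_extend h4 J {v | v ∉ C.verts ∧ v ∉ X} (by
      rintro r ⟨hr, hrX⟩
      rw [← hG r]
      congr 1
      ext w
      rw [SimpleGraph.mem_neighborSet, SimpleGraph.mem_neighborSet, hJo r hrX]
      exact ⟨fun h => h.1, fun h => ⟨h, fun h1 => hr (C.edge_vert h1)⟩⟩)
    {e | ∃ v ∈ e, v ∈ X} c (fun e _ => hc0 e) (by
      rintro v w h ⟨hv, hvX⟩ ⟨hw, hwX⟩
      exfalso
      exact h.ne (hone v w hv hw (hnX v hvX).1 (hnX w hwX).1 (hnX v hvX).2 (hnX w hwX).2)) (by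
      rintro r ⟨hr, hrX⟩ w w' hw hw' hP hP' h
      have key : ∀ t, J.Adj r t → s(r, t) ∈ {e : Sym2 V | ∃ v ∈ e, v ∈ X} → ∃ k, t = u k := by
        rintro t ht ⟨v, hv, hvX⟩
        rw [Sym2.mem_iff] at hv
        rcases hv with rfl | rfl
        · exact absurd hvX hrX
        · exact hQX r v hr hrX ht hvX
      obtain ⟨k, rfl⟩ := key w hw hP
      obtain ⟨k', rfl⟩ := key w' hw' hP'
      rw [hcu k r (hnX r hrX).1, hcu k' r (hnX r hrX).1] at h
      rw [hγi h])
  have hgz : ∀ v w, ¬ J.Adj v w → g s(v, w) = 0 := by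
    intro v w h
    by_contra h1
    exact h ((hg _).1 h1)
  have hpu : ∀ i k, p i ≠ u k := fun i k h => hup k i h.symm
  have hgu : ∀ k v, J.Adj v (u k) → (∀ j, v ≠ u j) → g s(v, u k) = γ k := by
    intro k v h hv
    rw [hgP _ ⟨u k, by simp, huX k⟩ h, hcu k v hv]
  have hg0' : ∀ v ∉ C.verts, ∑ w, g s(v, w) = 0 := by
    intro v hv
    by_cases hvX : v ∈ X
    · rcases (hX v).1 hvX with ⟨k, rfl⟩ | ⟨i, rfl⟩
      · rw [Fintype.sum_eq_add (z k) (p 0) (hzp k 0)]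
        · rw [Sym2.eq_swap, hgu k (z k) ((hJu k _).2 (Or.inl rfl)).symm (hzu k),
            Sym2.eq_swap, hgu k (p 0) ((hJu k _).2 (Or.inr rfl)).symm (hpu 0)]
          exact f4_two h4 _
        · intro w hw
          apply hgz
          rw [hJu]
          tauto
      · by_cases hi : p i = p 0
        · have hJ0 : ∀ k, J.Adj (p i) (u k) := fun k => Or.inr (Or.inl ⟨hi, k, rfl⟩)
          rw [← Finset.sum_subset (Finset.subset_univ (Finset.univ.image u)),
            Finset.sum_image (fun a _ b _ h => hu h), Fin.sum_univ_three,
            hgu 0 _ (hJ0 0) (hpu i), hgu 1 _ (hJ0 1) (hpu i), hgu 2 _ (hJ0 2) (hpu i)]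
          · exact hγs
          · intro w _ hw
            apply hgz
            intro h
            obtain ⟨-, k, rfl⟩ := hJp i w h
            exact hw (by simp)
        · apply Finset.sum_eq_zero
          intro w _
          apply hgz
          intro h
          exact hi (hJp i w h).1
    · exact hg0 v ⟨hv, hvX⟩
  obtain ⟨S, hS, hS1, hS2, hSe⟩ := labelling h4 C.spanningCoe J C.verts n1 n2 l
    (fun v hv => (hset v hv).1) (fun v hv w => (hset v hv).2.1 w)
    (fun v hv w h => hv (C.edge_vert h)) (cycle_reach hC)
    (fun v hv w => by
      rw [hJo v (fun h => hXK v h hv)]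
      exact (hset v hv).2.2 w)
    (fun v w h h1 => by
      have hv : v ∈ C.verts := C.edge_vert h
      exact ((hJo v (fun h => hXK v h hv) w).1 h1).2 h) g hg hg0'
  have hSJ : ∀ x v w, v ∈ X → s(v, w) ∈ S x → J.Adj v w := by
    intro x v w hv h
    rcases hS x h with h1 | h1
    · exact absurd (C.edge_vert h1) (hXK v hv)
    · exact h1
  have hPu : ∀ k x, s(u k, z k) ∈ S x ↔ s(u k, p 0) ∈ S x := by
    intro k x
    exact even_pair (Q := fun w => s(u k, w) ∈ S x) (hzp k 0)
      (fun w hw => (hJu k w).1 (hSJ x _ _ (huX k) hw)) (hSe x (u k))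
  obtain ⟨code, hcode1, hcode2⟩ := code_equiv h4 (fun k x => s(u k, z k) ∈ S x)
    (fun k => hS2 _ ((hJu k _).2 (Or.inl rfl))) (by
      intro x
      have h1 := hSe x (p 0)
      have h2 : {w | s(p 0, w) ∈ S x} =
          ↑((Finset.univ.filter fun k => s(u k, z k) ∈ S x).image u) := by
        ext w
        simp only [Finset.coe_image, Finset.coe_filter, Finset.mem_univ, true_and, Set.mem_image,
          Set.mem_ofPred_eq]
        constructor
        · intro h
          obtain ⟨-, k, rfl⟩ := hJp 0 w (hSJ x _ _ (hpX 0) h)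
          refine ⟨k, ?_, rfl⟩
          rw [hPu, Sym2.eq_swap]
          exact h
        · rintro ⟨k, hk, rfl⟩
          rw [hPu, Sym2.eq_swap] at hk
          exact hk
      rw [h2, Set.ncard_coe_finset, Finset.card_image_of_injective _ hu] at h1
      exact h1)
  refine ⟨S, code, ?_, hS1, ?_, hSe, hcode1, hcode2⟩
  · intro x v w hv h
    rcases hS x h with h1 | h1
    · exact C.adj_sub h1
    · exact ((hJo v hv w).1 h1).1
  · intro v w h1 h2 hv
    exact hS2 _ ((hJo v hv w).2 ⟨h1, h2⟩)

theorem cdc_nine {F : Type*} [Field F] [Fintype F] (h4 : Fintype.card F = 4) [Fintype V]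
    (G : SimpleGraph V) (hG : IsCubic G) (C : G.Subgraph) (hC : IsCycleSub C)
    (u : Fin 3 → V) (p : Fin 6 → V) (z : Fin 3 → V) (hu : Function.Injective u)
    (hp : Function.Injective p) (hup : ∀ i j, u i ≠ p j) (huK : ∀ i, u i ∉ C.verts)
    (hpK : ∀ i, p i ∉ C.verts)
    (hGu : ∀ k w, G.Adj (u k) w ↔ w = z k ∨ ∃ i, half i = k ∧ w = p i)
    (hzu : ∀ k j, z k ≠ u j) (hzp : ∀ k i, z k ≠ p i)
    (hGp : ∀ i w, G.Adj (p i) w → w = u (half i) ∨ ∃ j, w = p j)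
    (hone : ∀ y y', y ∉ C.verts → y' ∉ C.verts → (∀ i, y ≠ u i) → (∀ i, y' ≠ u i) →
      (∀ i, y ≠ p i) → (∀ i, y' ≠ p i) → y = y') :
    ∃ D : Multiset G.Subgraph, IsCDC G D := by
  obtain ⟨X, hX⟩ : ∃ X : Set V, ∀ v, v ∈ X ↔ (∃ k, v = u k) ∨ ∃ i, v = p i :=
    ⟨{v | (∃ k, v = u k) ∨ ∃ i, v = p i}, fun v => Iff.rfl⟩
  obtain ⟨S, code, hSG, hS1, hS2, hSe, hcode, hPc⟩ := nine_flow h4 G hG C hC u p z hu hup huK hpK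
    hGu hzu hzp hGp hone X hX
  have huX : ∀ k, u k ∈ X := fun k => (hX _).2 (Or.inl ⟨k, rfl⟩)
  have hpX : ∀ i, p i ∈ X := fun i => (hX _).2 (Or.inr ⟨i, rfl⟩)
  have hzX : ∀ k, z k ∉ X := by
    intro k h
    rcases (hX _).1 h with ⟨j, hj⟩ | ⟨j, hj⟩
    · exact hzu k j hj
    · exact hzp k j hj
  have hXK : ∀ v ∈ X, v ∉ C.verts := by
    intro v hv
    rcases (hX _).1 hv with ⟨j, rfl⟩ | ⟨j, rfl⟩
    · exact huK j
    · exact hpK j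
  have hpu : ∀ i k, p i ≠ u k := fun i k h => hup k i h.symm
  have hleg : ∀ i, G.Adj (u (half i)) (p i) := fun i => (hGu _ _).2 (Or.inr ⟨i, rfl, rfl⟩)
  -- degrees in the hexagon graph
  have hW2 : ∀ i, (Finset.univ.filter fun j => G.Adj (p i) (p j)).card = 2 := by
    intro i
    have h1 : G.neighborSet (p i) =
        ↑(insert (u (half i)) ((Finset.univ.filter fun j => G.Adj (p i) (p j)).image p)) := by
      ext w
      simp only [SimpleGraph.mem_neighborSet, Finset.coe_insert, Finset.coe_image,
        Finset.coe_filter, Finset.mem_univ, true_and, Set.mem_insert_iff, Set.mem_image,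
        Set.mem_ofPred_eq]
      constructor
      · intro h
        rcases hGp i w h with h1 | ⟨j, rfl⟩
        · exact Or.inl h1
        · exact Or.inr ⟨j, h, rfl⟩
      · rintro (rfl | ⟨j, h, rfl⟩)
        · exact (hleg i).symm
        · exact h
    have h2 := hG (p i)
    rw [h1, Set.ncard_coe_finset, Finset.card_insert_of_notMem,
      Finset.card_image_of_injective _ hp] at h2
    · omega
    · simp only [Finset.mem_image, not_exists, not_and]
      intro j _ h
      exact hpu j _ h
  obtain ⟨L, hLs, hLi, hLo⟩ := comb (fun i j => G.Adj (p i) (p j)) (fun i j h => h.symm)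
    (fun i h => h.ne rfl) hW2
  let Has : Fin 6 → Fin 4 → Prop := fun i l => ∃ j, G.Adj (p i) (p j) ∧ L i j = l
  let T0 : Set (Sym2 V) := C.edgeSet ∪ {e | ∃ i j, G.Adj (p i) (p j) ∧ e = s(p i, p j)}
  let T : F → Set (Sym2 V) := fun x =>
    {e | (e ∈ S x ∧ e ∈ G.edgeSet ∧ ∃ v ∈ e, v ∉ X) ∨
      (∃ i j, G.Adj (p i) (p j) ∧ L i j = code x ∧ e = s(p i, p j)) ∨
      ∃ i, Has i (code x) ∧ e = s(u (half i), p i)}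
  have M1 : ∀ x v w, v ∉ X → (s(v, w) ∈ T x ↔ s(v, w) ∈ S x) := by
    intro x v w hv
    constructor
    · rintro (h | ⟨i, j, -, -, h⟩ | ⟨i, -, h⟩)
      · exact h.1
      · exfalso
        rw [Sym2.eq_iff] at h
        rcases h with h | h
        · exact hv (h.1 ▸ hpX i)
        · exact hv (h.1 ▸ hpX j)
      · exfalso
        rw [Sym2.eq_iff] at h
        rcases h with h | h
        · exact hv (h.1 ▸ huX _)
        · exact hv (h.1 ▸ hpX i)
    · intro h
      exact Or.inl ⟨h, hSG x v w hv h, v, by simp, hv⟩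
  have M2 : ∀ x k w, s(u k, w) ∈ T x ↔ (w = z k ∧ s(u k, z k) ∈ S x) ∨
      ∃ i, (half i = k ∧ Has i (code x)) ∧ w = p i := by
    intro x k w
    constructor
    · rintro (⟨h1, h2, v, hv, hvX⟩ | ⟨i, j, -, -, h⟩ | ⟨i, hi, h⟩)
      · left
        rw [Sym2.mem_iff] at hv
        rcases hv with rfl | rfl
        · exact absurd (huX k) hvX
        · rcases (hGu k v).1 h2 with rfl | ⟨i, -, rfl⟩
          · exact ⟨rfl, h1⟩
          · exact absurd (hpX i) hvX
      · exfalso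
        rw [Sym2.eq_iff] at h
        rcases h with h | h
        · exact hup _ _ h.1
        · exact hup _ _ h.1
      · right
        rw [Sym2.eq_iff] at h
        rcases h with h | h
        · exact ⟨i, ⟨(hu h.1).symm, hi⟩, h.2⟩
        · exact absurd h.1 (hup _ _)
    · rintro (⟨rfl, h⟩ | ⟨i, ⟨rfl, hi⟩, rfl⟩)
      · exact Or.inl ⟨h, (hGu k _).2 (Or.inl rfl), z k, by simp, hzX k⟩
      · exact Or.inr (Or.inr ⟨i, hi, rfl⟩)
  have M3 : ∀ x i w, s(p i, w) ∈ T x ↔ (w = u (half i) ∧ Has i (code x)) ∨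
      ∃ j, (G.Adj (p i) (p j) ∧ L i j = code x) ∧ w = p j := by
    intro x i w
    constructor
    · rintro (⟨h1, h2, v, hv, hvX⟩ | ⟨i', j, h1, h2, h⟩ | ⟨i', hi, h⟩)
      · exfalso
        rw [Sym2.mem_iff] at hv
        rcases hv with rfl | rfl
        · exact hvX (hpX i)
        · rcases hGp i v h2 with rfl | ⟨j, rfl⟩
          · exact hvX (huX _)
          · exact hvX (hpX j)
      · right
        rw [Sym2.eq_iff] at h
        rcases h with h | h
        · obtain rfl := hp h.1
          exact ⟨j, ⟨h1, h2⟩, h.2⟩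
        · obtain rfl := hp h.1
          exact ⟨i', ⟨h1.symm, by rw [hLs]; exact h2⟩, h.2⟩
      · left
        rw [Sym2.eq_iff] at h
        rcases h with h | h
        · exact absurd h.1 (hpu _ _)
        · obtain rfl := hp h.1
          exact ⟨h.2, hi⟩
    · rintro (⟨rfl, h⟩ | ⟨j, ⟨h1, h2⟩, rfl⟩)
      · exact Or.inr (Or.inr ⟨i, h, Sym2.eq_swap⟩)
      · exact Or.inr (Or.inl ⟨i, j, h1, h2, rfl⟩)
  have hT0p : ∀ i w, s(p i, w) ∈ T0 ↔ ∃ j, G.Adj (p i) (p j) ∧ p j = w := by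
    intro i w
    constructor
    · rintro (h | ⟨i', j, h1, h⟩)
      · exact absurd (C.edge_vert h) (hpK i)
      · rw [Sym2.eq_iff] at h
        rcases h with h | h
        · obtain rfl := hp h.1
          exact ⟨j, h1, h.2.symm⟩
        · obtain rfl := hp h.1
          exact ⟨i', h1.symm, h.2.symm⟩
    · rintro ⟨j, h, rfl⟩
      exact Or.inr ⟨i, j, h, rfl⟩
  have hT0o : ∀ v w, (∀ i, v ≠ p i) → (s(v, w) ∈ T0 ↔ s(v, w) ∈ C.edgeSet) := by
    intro v w hv
    constructor
    · rintro (h | ⟨i', j, h1, h⟩)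
      · exact h
      · rw [Sym2.eq_iff] at h
        rcases h with h | h
        · exact absurd h.1 (hv _)
        · exact absurd h.1 (hv _)
    · exact fun h => Or.inl h
  refine cdc_of_even_sets_option G hG T0 T ?_ ?_ ?_ ?_ ?_ ?_
  · rintro e (h | ⟨i, j, h, rfl⟩)
    · exact C.edgeSet_subset h
    · exact h
  · intro v
    by_cases hv : ∃ i, v = p i
    · obtain ⟨i, rfl⟩ := hv
      have h1 : {w | s(p i, w) ∈ T0} =
          ↑((Finset.univ.filter fun j => G.Adj (p i) (p j)).image p) := by
        ext w
        simp only [Set.mem_ofPred_eq, hT0p, Finset.coe_image, Finset.coe_filter, Finset.mem_univ,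
          true_and, Set.mem_image]
      rw [h1, Set.ncard_coe_finset, Finset.card_image_of_injective _ hp, hW2]
      exact even_two
    · push Not at hv
      have h1 : {w | s(v, w) ∈ T0} = {w | s(v, w) ∈ C.edgeSet} := by
        ext w
        exact hT0o v w hv
      rw [h1]
      exact even_cycle_set hC v
  · rintro x e (h | ⟨i, j, h, -, rfl⟩ | ⟨i, -, rfl⟩)
    · exact h.2.1
    · exact h
    · exact hleg i
  · intro x v
    by_cases hv : v ∈ X
    · rcases (hX v).1 hv with ⟨k, rfl⟩ | ⟨i, rfl⟩
      · set B := (Finset.univ.filter fun i => half i = k ∧ Has i (code x)) with hB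
        have hodd : Odd B.card ↔ s(u k, z k) ∈ S x := by
          rw [hPc]
          exact hLo k (code x)
        by_cases hz : s(u k, z k) ∈ S x
        · have h1 : {w | s(u k, w) ∈ T x} = ↑(insert (z k) (B.image p)) := by
            ext w
            simp only [Set.mem_ofPred_eq, M2, Finset.coe_insert, Finset.coe_image, hB,
              Finset.coe_filter, Finset.mem_univ, true_and, Set.mem_insert_iff, Set.mem_image]
            constructor
            · rintro (h | ⟨i, h, rfl⟩)
              · exact Or.inl h.1
              · exact Or.inr ⟨i, h, rfl⟩
            · rintro (h | ⟨i, h, rfl⟩)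
              · exact Or.inl ⟨h, hz⟩
              · exact Or.inr ⟨i, h, rfl⟩
          rw [h1, Set.ncard_coe_finset, Finset.card_insert_of_notMem,
            Finset.card_image_of_injective _ hp]
          · exact (hodd.2 hz).add_one
          · simp only [Finset.mem_image, not_exists, not_and]
            intro j _ h
            exact hzp k j h.symm
        · have h1 : {w | s(u k, w) ∈ T x} = ↑(B.image p) := by
            ext w
            simp only [Set.mem_ofPred_eq, M2, Finset.coe_image, hB,
              Finset.coe_filter, Finset.mem_univ, true_and, Set.mem_image]
            constructor
            · rintro (h | ⟨i, h, rfl⟩)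
              · exact absurd h.2 hz
              · exact ⟨i, h, rfl⟩
            · rintro ⟨i, h, rfl⟩
              exact Or.inr ⟨i, h, rfl⟩
          rw [h1, Set.ncard_coe_finset, Finset.card_image_of_injective _ hp,
            ← Nat.not_odd_iff_even, hodd]
          exact hz
      · by_cases hi : Has i (code x)
        · obtain ⟨j, hj, hl⟩ := hi
          have h1 : {w | s(p i, w) ∈ T x} = {u (half i), p j} := by
            ext w
            simp only [Set.mem_ofPred_eq, M3, Set.mem_insert_iff, Set.mem_singleton_iff]
            constructor
            · rintro (h | ⟨j', h, rfl⟩)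
              · exact Or.inl h.1
              · right
                rw [hLi i j j' hj h.1 (hl.trans h.2.symm)]
            · rintro (h | h)
              · exact Or.inl ⟨h, j, hj, hl⟩
              · exact Or.inr ⟨j, ⟨hj, hl⟩, h⟩
          rw [h1, Set.ncard_pair (hup _ _)]
          exact even_two
        · have h1 : {w | s(p i, w) ∈ T x} = ∅ := by
            ext w
            simp only [Set.mem_ofPred_eq, M3, Set.mem_empty_iff_false, iff_false]
            rintro (h | ⟨j', h, rfl⟩)
            · exact hi h.2
            · exact hi ⟨j', h⟩
          rw [h1, Set.ncard_empty]
          exact Even.zero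
    · have h1 : {w | s(v, w) ∈ T x} = {w | s(v, w) ∈ S x} := by
        ext w
        exact M1 x v w hv
      rw [h1]
      exact hSe x v
  · rintro e he (h | ⟨i, j, h, rfl⟩)
    · refine Eq.trans ?_ (hS1 e h)
      congr 1
      ext x
      simp only [Finset.mem_filter, Finset.mem_univ, true_and]
      induction e with | _ v w
      exact M1 x v w fun hv => hXK v hv (C.edge_vert h)
    · refine Eq.trans ?_ (hcode (L i j))
      congr 1
      ext x
      simp only [Finset.mem_filter, Finset.mem_univ, true_and]
      rw [M3]
      constructor
      · rintro (h1 | ⟨j', h1, h2⟩)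
        · exact absurd h1.1 (hpu _ _)
        · rw [hp h2]
          exact h1.2.symm
      · intro h1
        exact Or.inr ⟨j, ⟨h, h1.symm⟩, rfl⟩
  · have hout : ∀ v w, G.Adj v w → s(v, w) ∉ T0 → v ∉ X →
        (Finset.univ.filter fun x => s(v, w) ∈ T x).card = 2 := by
      intro v w h h0 hv
      refine Eq.trans ?_ (hS2 v w h (fun h1 => h0 (Or.inl h1)) hv)
      congr 1
      ext x
      simp only [Finset.mem_filter, Finset.mem_univ, true_and]
      exact M1 x v w hv
    have hlegc : ∀ i, (Finset.univ.filter fun x => s(u (half i), p i) ∈ T x).card = 2 := by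
      intro i
      obtain ⟨j1, j2, h12, hj⟩ := Finset.card_eq_two.1 (hW2 i)
      have hj' : ∀ j, G.Adj (p i) (p j) ↔ j = j1 ∨ j = j2 := by
        intro j
        have := Finset.ext_iff.1 hj j
        simpa using this
      have h1 : (Finset.univ.filter fun x => s(u (half i), p i) ∈ T x) =
          (Finset.univ.filter fun x => code x = L i j1) ∪
          (Finset.univ.filter fun x => code x = L i j2) := by
        ext x
        simp only [Finset.mem_filter, Finset.mem_univ, true_and, Finset.mem_union]
        rw [M2]
        constructor
        · rintro (h | ⟨i', ⟨-, j, h2, h3⟩, h4⟩)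
          · exact absurd h.1.symm (hzp _ _)
          · obtain rfl := hp h4
            rcases (hj' j).1 h2 with rfl | rfl
            · exact Or.inl h3.symm
            · exact Or.inr h3.symm
        · rintro (h | h)
          · exact Or.inr ⟨i, ⟨rfl, j1, (hj' _).2 (Or.inl rfl), h.symm⟩, rfl⟩
          · exact Or.inr ⟨i, ⟨rfl, j2, (hj' _).2 (Or.inr rfl), h.symm⟩, rfl⟩
      rw [h1, Finset.card_union_of_disjoint, hcode, hcode]
      rw [Finset.disjoint_left]
      intro x h2 h3
      simp only [Finset.mem_filter, Finset.mem_univ, true_and] at h2 h3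
      exact h12 (hLi i j1 j2 ((hj' _).2 (Or.inl rfl)) ((hj' _).2 (Or.inr rfl))
        (h2.symm.trans h3))
    intro e he h0
    induction e with | _ v w
    rw [SimpleGraph.mem_edgeSet] at he
    by_cases hv : v ∈ X
    · by_cases hw : w ∈ X
      · rcases (hX v).1 hv with ⟨k, rfl⟩ | ⟨i, rfl⟩
        · rcases (hGu k w).1 he with rfl | ⟨i, rfl, rfl⟩
          · exact absurd hw (hzX k)
          · convert hlegc i
        · rcases hGp i w he with rfl | ⟨j, rfl⟩
          · rw [Sym2.eq_swap]
            convert hlegc i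
          · exact absurd (Or.inr ⟨i, j, he, rfl⟩) h0
      · rw [Sym2.eq_swap] at h0 ⊢
        convert hout w v he.symm h0 hw
    · convert hout v w he h0 hv

/-- a bridgeless cubic graph of order n with a cycle of length at least n - 10
has a cycle double cover. -/
theorem cdc_of_long_cycle {V : Type*} [Fintype V]
    (G : SimpleGraph V) (hG : IsCubic G)
    (hbridgeless : ∀ e, ¬ G.IsBridge e)
    (C : G.Subgraph) (hC : IsCycleSub C)
    (hlong : Fintype.card V - 10 ≤ C.verts.ncard) :
    ∃ D : Multiset G.Subgraph, IsCDC G D := by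
  letI : Fintype (GaloisField 2 2) := Fintype.ofFinite _
  have h4 : Fintype.card (GaloisField 2 2) = 4 := by
    rw [← Nat.card_eq_fintype_card, GaloisField.card 2 2 (by norm_num)]
    norm_num
  have hK : C.verts.Nonempty := hC.1.nonempty
  have hcard : (C.vertsᶜ : Set V).ncard ≤ 10 := by
    have h1 := Set.ncard_add_ncard_compl C.verts
    rw [Nat.card_eq_fintype_card] at h1
    omega
  let GR : SimpleGraph V :=
    { Adj := fun v w => G.Adj v w ∧ v ∉ C.verts ∧ w ∉ C.verts
      symm := ⟨fun v w h => ⟨h.1.symm, h.2.2, h.2.1⟩⟩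
      loopless := ⟨fun v h => G.loopless.irrefl v h.1⟩ }
  by_cases hcol : ∃ c, Prop3 GR c
  · obtain ⟨c, hc⟩ := hcol
    obtain ⟨γ, hγ, hγ0, -⟩ := f4_three h4
    refine cdc_colourable h4 G hG C hC (fun e => γ (c e)) (fun e => hγ0 _) ?_
    intro v w w' hv hw hw' h1 h2 h3
    exact hc v w w' ⟨h1, hv, hw⟩ ⟨h2, hv, hw'⟩ (hγ h3)
  · obtain ⟨H, ⟨hle, hH⟩, hmin⟩ := WellFounded.has_min (wellFounded_lt (α := SimpleGraph V))
      {H | H ≤ GR ∧ ¬ ∃ c, Prop3 H c} ⟨GR, le_refl _, hcol⟩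
    obtain ⟨u, p, z, hu, hp, hup, huK, hpK, hGu, hzu, hzp, hGp, hone⟩ :=
      crit_structure hG hbridgeless C.verts hK hcard (H := H) (fun v w h => hle h) hH (by
        intro x y hxy
        by_contra hcon
        have hlt : H.deleteEdges {s(x, y)} < H := by
          refine lt_of_le_of_ne (SimpleGraph.deleteEdges_le _) ?_
          intro heq
          rw [← heq, SimpleGraph.deleteEdges_adj] at hxy
          exact hxy.2 rfl
        exact hmin _ ⟨hlt.le.trans hle, hcon⟩ hlt)
    exact cdc_nine h4 G hG C hC u p z hu hp hup huK hpK hGu hzu hzp hGp hone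

end SnarkPaper
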